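/- Let M ⊆ F be a finitely generated graded A-module with in_{(ω,ε)}(M) componentwise linear. If β_i(M) = β_i(in_{(ω,ε)}(M)) for some i ≥ 0, then the syzygy module Ω_j^A(M) is componentwise linear for all j ≥ i − 2. -/

import Mathlib

/-!  Basic setup: the polynomial ring `A = K[X_1,…,X_n]`, a graded free module
`F = ⊕_{j} A(-d_j)` realized as `Fin k → A`, weight orders `(ω, ε)`, initial
modules, Hilbert functions, graded free resolutions, Betti numbers,
regularity and componentwise notions, following Caviglia–Varbaro,
"Componentwise regularity (I)". -/

namespace CregPaper

abbrev A (K : Type*) [Field K] (n : ℕ) := MvPolynomial (Fin n) K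

variable {K : Type*} [Field K] {n k : ℕ}

/-- `(ω)`-weight of an exponent vector `u`. -/
def wdeg (ω : Fin n → ℕ) (u : Fin n →₀ ℕ) : ℕ := u.sum fun i e => ω i * e

/-- total (standard) degree of an exponent vector `u`. -/
def tdeg (u : Fin n →₀ ℕ) : ℕ := u.sum fun _ e => e

/-- largest `(ω,ε)`-weight of a monomial in the support of `f ∈ F`. -/
noncomputable def maxWt (ω : Fin n → ℕ) (ε : Fin k → ℕ) (f : Fin k → A K n) : ℕ :=
  Finset.univ.sup fun j => (f j).support.sup fun u => wdeg ω u + ε j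

/-- the initial part `in_{(ω,ε)}(f)`: the sum of the terms of `f` of largest weight. -/
noncomputable def inForm (ω : Fin n → ℕ) (ε : Fin k → ℕ) (f : Fin k → A K n) :
    Fin k → A K n :=
  fun j => ∑ u ∈ (f j).support.filter fun u => wdeg ω u + ε j = maxWt ω ε f,
    MvPolynomial.monomial u ((f j).coeff u)

/-- the initial module `in_{(ω,ε)}(M)`. -/
noncomputable def inMod (ω : Fin n → ℕ) (ε : Fin k → ℕ)
    (M : Submodule (A K n) (Fin k → A K n)) : Submodule (A K n) (Fin k → A K n) :=
  Submodule.span (A K n) {g | ∃ f ∈ M, f ≠ 0 ∧ g = inForm ω ε f}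

/-- `f ∈ F = ⊕_j A(-d_j)` is homogeneous of (standard) degree `a`. -/
def IsHomog (d : Fin k → ℕ) (a : ℕ) (f : Fin k → A K n) : Prop :=
  ∀ j, ∀ u ∈ (f j).support, tdeg u + d j = a

/-- the `K`-subspace of `F` of homogeneous elements of degree `a`. -/
noncomputable def homogSub (d : Fin k → ℕ) (a : ℕ) : Submodule K (Fin k → A K n) where
  carrier := {f | IsHomog d a f}
  add_mem' := by
    intro f g hf hg j u hu
    rcases Finset.mem_union.mp (MvPolynomial.support_add hu) with h | h
    · exact hf j u h
    · exact hg j u h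
  zero_mem' := by intro j u hu; simp at hu
  smul_mem' := by
    intro c f hf j u hu
    exact hf j u (MvPolynomial.support_smul hu)

/-- the degree-`a` homogeneous component of `f ∈ F`. -/
noncomputable def homogComp (d : Fin k → ℕ) (f : Fin k → A K n) (a : ℕ) : Fin k → A K n :=
  fun j => ∑ u ∈ (f j).support.filter fun u => tdeg u + d j = a,
    MvPolynomial.monomial u ((f j).coeff u)

/-- `M ⊆ F` is a graded submodule. -/
def IsGradedSub (d : Fin k → ℕ) (M : Submodule (A K n) (Fin k → A K n)) : Prop :=
  ∀ f ∈ M, ∀ a, homogComp d f a ∈ M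

/-- Hilbert function of `M ⊆ F` in degree `a`. -/
noncomputable def hilb (d : Fin k → ℕ) (M : Submodule (A K n) (Fin k → A K n)) (a : ℕ) : ℕ :=
  Module.finrank K ↥(Submodule.restrictScalars K M ⊓ homogSub d a)

/-- the homogeneous maximal ideal `m = (X_1,…,X_n)` of `A`. -/
noncomputable def mIdeal (K : Type*) [Field K] (n : ℕ) : Ideal (A K n) :=
  RingHom.ker (MvPolynomial.constantCoeff : A K n →+* K)

/-- graded Betti number `β_{0,a}(M) = dim_K (M/mM)_a`, the number of minimal
generators of the graded module `M` in degree `a`. -/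
noncomputable def beta0 (d : Fin k → ℕ) (M : Submodule (A K n) (Fin k → A K n)) (a : ℕ) : ℕ :=
  hilb d M a - hilb d (mIdeal K n • M) a

/-- A graded free resolution of a graded submodule `M` of `F = ⊕_j A(-d_j)`:
`⋯ → A^{rk 1} → A^{rk 0} → M → 0`, each free module coming with degree shifts
`sh i`, all maps graded of degree `0`. -/
structure GFRes (d : Fin k → ℕ) (M : Submodule (A K n) (Fin k → A K n)) where
  rk : ℕ → ℕ
  sh : (i : ℕ) → Fin (rk i) → ℕ
  aug : (Fin (rk 0) → A K n) →ₗ[A K n] (Fin k → A K n)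
  diff : (i : ℕ) → ((Fin (rk (i+1)) → A K n) →ₗ[A K n] (Fin (rk i) → A K n))
  aug_range : LinearMap.range aug = M
  aug_hom : ∀ l, IsHomog d (sh 0 l) (aug (Pi.single l 1))
  diff_hom : ∀ i l, IsHomog (sh i) (sh (i+1) l) (diff i (Pi.single l 1))
  ex0 : LinearMap.range (diff 0) = LinearMap.ker aug
  exs : ∀ i, LinearMap.range (diff (i+1)) = LinearMap.ker (diff i)

/-- minimality of a graded free resolution: all entries of the differential
matrices lie in the maximal ideal. -/
def GFRes.Minimal {d : Fin k → ℕ} {M : Submodule (A K n) (Fin k → A K n)}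
    (res : GFRes d M) : Prop :=
  ∀ i x l, res.diff i x l ∈ mIdeal K n

/-- the graded Betti number `β_{i,j}(M)` read off from a (minimal) resolution. -/
noncomputable def GFRes.betti {d : Fin k → ℕ} {M : Submodule (A K n) (Fin k → A K n)}
    (res : GFRes d M) (i j : ℕ) : ℕ :=
  (Finset.univ.filter fun l => res.sh i l = j).card

/-- `reg_A(M) ≤ r`: there is a minimal graded free resolution of `M` with
all shifts in homological degree `i` bounded by `i + r`. -/
def RegLE (d : Fin k → ℕ) (M : Submodule (A K n) (Fin k → A K n)) (r : ℕ) : Prop :=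
  ∃ res : GFRes d M, res.Minimal ∧ ∀ i l, res.sh i l ≤ i + r

/-- `M_{⟨a⟩}`: the submodule generated by the homogeneous elements of degree `a` of `M`. -/
noncomputable def compSub (d : Fin k → ℕ) (M : Submodule (A K n) (Fin k → A K n)) (a : ℕ) :
    Submodule (A K n) (Fin k → A K n) :=
  Submodule.span (A K n) {f | f ∈ M ∧ IsHomog d a f}

/-- `M` is `r`-componentwise regular: `reg (M_{⟨a⟩}) ≤ a + r` for all `a`. -/
def CWRegLE (d : Fin k → ℕ) (M : Submodule (A K n) (Fin k → A K n)) (r : ℕ) : Prop :=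
  ∀ a, RegLE d (compSub d M a) (a + r)

/-- `M` is componentwise linear: each `M_{⟨a⟩}` is zero or has regularity `a`. -/
def CompLinear (d : Fin k → ℕ) (M : Submodule (A K n) (Fin k → A K n)) : Prop :=
  ∀ a, compSub d M a = ⊥ ∨ RegLE d (compSub d M a) a

/-- `M` is generated in degrees `≤ a`. -/
def GenInDegLE (d : Fin k → ℕ) (M : Submodule (A K n) (Fin k → A K n)) (a : ℕ) : Prop :=
  M ≤ Submodule.span (A K n) {f | f ∈ M ∧ ∃ b ≤ a, IsHomog d b f}

end CregPaper

namespace CregPaper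

section Graded

variable {K : Type*} [Field K] {n : ℕ} {ι κ μ : Type}

open MvPolynomial

theorem wdeg_add (w : Fin n → ℕ) (u v : Fin n →₀ ℕ) : wdeg w (u + v) = wdeg w u + wdeg w v :=
  Finsupp.sum_add_index' (by simp) (by intros; ring)

@[simp] theorem wdeg_zero (w : Fin n → ℕ) : wdeg w 0 = 0 := Finsupp.sum_zero_index

theorem tdeg_eq_wdeg_one (u : Fin n →₀ ℕ) : tdeg u = wdeg 1 u := by
  simp [tdeg, wdeg]

theorem eq_zero_of_wdeg_one {u : Fin n →₀ ℕ} (h : wdeg 1 u = 0) : u = 0 := by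
  ext i
  by_contra hi
  have : ∀ j ∈ u.support, (1 : Fin n → ℕ) j * u j = 0 := by
    simpa [wdeg, Finsupp.sum] using h
  exact hi (by simpa using this i (by simpa using hi))

theorem vec_ext {f g : ι → A K n} (h : ∀ j u, coeff u (f j) = coeff u (g j)) : f = g :=
  funext fun j => MvPolynomial.ext _ _ (h j)

open Classical in
theorem coeff_sum_filter_monomial (p : (Fin n →₀ ℕ) → Prop) (f : A K n) (u : Fin n →₀ ℕ) :
    coeff u (∑ v ∈ f.support with p v, monomial v (coeff v f)) = if p u then coeff u f else 0 := by
  simp only [coeff_sum, coeff_monomial, Finset.sum_ite_eq', Finset.mem_filter, mem_support_iff]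
  grind

open Classical in
/-- Keep only the terms of a vector whose position and exponent satisfy `p`. -/
noncomputable def cut (p : ι → (Fin n →₀ ℕ) → Prop) : (ι → A K n) →ₗ[K] (ι → A K n) where
  toFun f j := ∑ u ∈ (f j).support with p j u, monomial u (coeff u (f j))
  map_add' f g := by
    refine vec_ext fun j u => ?_
    refine (coeff_sum_filter_monomial _ _ _).trans (Eq.trans ?_ ((congrArg₂ (· + ·)
      (coeff_sum_filter_monomial (p j) _ _).symm (coeff_sum_filter_monomial (p j) _ _).symm).trans
      (coeff_add _ _ _).symm))
    split_ifs <;> simp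
  map_smul' c f := by
    refine vec_ext fun j u => ?_
    refine (coeff_sum_filter_monomial _ _ _).trans (Eq.trans ?_ (congrArg (c * ·)
      (coeff_sum_filter_monomial (p j) _ _).symm))
    split_ifs <;> simp

open Classical in
theorem coeff_cut (p : ι → (Fin n →₀ ℕ) → Prop) (f : ι → A K n) (j : ι) (u : Fin n →₀ ℕ) :
    coeff u (cut p f j) = if p j u then coeff u (f j) else 0 :=
  coeff_sum_filter_monomial _ _ _

/-- `f` is homogeneous of degree `a` for the grading given by the weights `w` and shifts `d`. -/
def Hg (w : Fin n → ℕ) (d : ι → ℕ) (a : ℕ) (f : ι → A K n) : Prop :=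
  ∀ j u, coeff u (f j) ≠ 0 → wdeg w u + d j = a

/-- All terms of `f` have degree `< b`. -/
def WLt (w : Fin n → ℕ) (d : ι → ℕ) (b : ℕ) (f : ι → A K n) : Prop :=
  ∀ j u, coeff u (f j) ≠ 0 → wdeg w u + d j < b

/-- The component of degree `a`. -/
noncomputable abbrev cmp (w : Fin n → ℕ) (d : ι → ℕ) (a : ℕ) : (ι → A K n) →ₗ[K] (ι → A K n) :=
  cut fun j u => wdeg w u + d j = a

/-- A submodule closed under taking homogeneous components. -/
def Gr (w : Fin n → ℕ) (d : ι → ℕ) (M : Submodule (A K n) (ι → A K n)) : Prop :=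
  ∀ f ∈ M, ∀ a, cmp w d a f ∈ M

/-- A linear map preserving degrees. -/
def GM (w : Fin n → ℕ) (d : ι → ℕ) (e : κ → ℕ) (φ : (ι → A K n) →ₗ[A K n] (κ → A K n)) : Prop :=
  ∀ a f, Hg w d a f → Hg w e a (φ f)

section Basic

variable {w : Fin n → ℕ} {d : ι → ℕ} {e : κ → ℕ} {a b c : ℕ} {f g : ι → A K n}

theorem hg_zero : Hg w d a (0 : ι → A K n) := by intro j u h; simp at h

theorem wlt_of_zero : WLt w d a (0 : ι → A K n) := by intro j u h; simp at h

theorem Hg.add (hf : Hg w d a f) (hg : Hg w d a g) : Hg w d a (f + g) := by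
  intro j u h
  by_contra hc
  have h1 := not_imp_comm.1 (hf j u) hc
  have h2 := not_imp_comm.1 (hg j u) hc
  simp [h1, h2] at h

theorem WLt.add (hf : WLt w d a f) (hg : WLt w d a g) : WLt w d a (f + g) := by
  intro j u h
  by_contra hc
  have h1 := not_imp_comm.1 (hf j u) hc
  have h2 := not_imp_comm.1 (hg j u) hc
  simp [h1, h2] at h

theorem Hg.neg (hf : Hg w d a f) : Hg w d a (-f) := fun j u h => hf j u (by simpa using h)

theorem WLt.neg (hf : WLt w d a f) : WLt w d a (-f) := fun j u h => hf j u (by simpa using h)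

theorem Hg.sub (hf : Hg w d a f) (hg : Hg w d a g) : Hg w d a (f - g) :=
  sub_eq_add_neg f g ▸ hf.add hg.neg

theorem WLt.sub (hf : WLt w d a f) (hg : WLt w d a g) : WLt w d a (f - g) :=
  sub_eq_add_neg f g ▸ hf.add hg.neg

theorem Hg.sum {α : Type*} {s : Finset α} {F : α → ι → A K n} (h : ∀ i ∈ s, Hg w d a (F i)) :
    Hg w d a (∑ i ∈ s, F i) :=
  Finset.sum_induction F (Hg w d a) (fun _ _ => Hg.add) hg_zero h

theorem WLt.sum {α : Type*} {s : Finset α} {F : α → ι → A K n} (h : ∀ i ∈ s, WLt w d a (F i)) :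
    WLt w d a (∑ i ∈ s, F i) :=
  Finset.sum_induction F (WLt w d a) (fun _ _ => WLt.add) wlt_of_zero h

theorem Hg.wlt (hf : Hg w d a f) (h : a < b) : WLt w d b f := fun j u hu => hf j u hu ▸ h

theorem WLt.mono (hf : WLt w d a f) (h : a ≤ b) : WLt w d b f :=
  fun j u hu => (hf j u hu).trans_le h

theorem hg_cmp (w : Fin n → ℕ) (d : ι → ℕ) (a : ℕ) (f : ι → A K n) : Hg w d a (cmp w d a f) := by
  intro j u h
  rw [coeff_cut] at h
  grind

theorem Hg.cmp_eq (hf : Hg w d a f) : cmp w d a f = f := by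
  refine vec_ext fun j u => ?_
  have := hf j u
  rw [coeff_cut]
  grind

theorem Hg.cmp_ne (hf : Hg w d a f) (h : b ≠ a) : cmp w d b f = 0 := by
  refine vec_ext fun j u => ?_
  have := hf j u
  rw [coeff_cut]
  simp only [Pi.zero_apply, coeff_zero]
  grind

theorem WLt.cmp_eq_zero (hf : WLt w d b f) (h : b ≤ a) : cmp w d a f = 0 := by
  refine vec_ext fun j u => ?_
  have := hf j u
  rw [coeff_cut]
  simp only [Pi.zero_apply, coeff_zero]
  grind

theorem WLt.of_cmp_eq_zero (hf : WLt w d (b + 1) f) (h : cmp w d b f = 0) : WLt w d b f := by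
  intro j u hu
  have h1 := hf j u hu
  have h2 := congrArg (coeff u) (congrFun h j)
  rw [coeff_cut] at h2
  simp only [Pi.zero_apply, coeff_zero] at h2
  grind

theorem WLt.eq_zero (hf : WLt w d 0 f) : f = 0 :=
  vec_ext fun j u => by
    by_contra hu
    exact Nat.not_lt_zero _ (hf j u hu)

theorem WLt.cut_apply {p : ι → (Fin n →₀ ℕ) → Prop} (hf : WLt w d b f) : WLt w d b (cut p f) := by
  intro j u hu
  rw [coeff_cut] at hu
  exact hf j u (by grind)

theorem cmp_comm {w' : Fin n → ℕ} {d' : ι → ℕ} (a b : ℕ) (f : ι → A K n) :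
    cmp w d a (cmp w' d' b f) = cmp w' d' b (cmp w d a f) := by
  refine vec_ext fun j u => ?_
  simp only [coeff_cut]
  grind

theorem WLt.sum_cmp (hf : WLt w d b f) : f = ∑ a ∈ Finset.range b, cmp w d a f := by
  refine vec_ext fun j u => ?_
  have := hf j u
  simp only [Finset.sum_apply, coeff_sum, coeff_cut]
  by_cases h : coeff u (f j) = 0
  · simp [h]
  · rw [Finset.sum_eq_single (wdeg w u + d j)]
    · simp
    · grind
    · intro hb
      exact absurd (Finset.mem_range.2 (this h)) hb

theorem exists_wlt [Fintype ι] (w : Fin n → ℕ) (d : ι → ℕ) (f : ι → A K n) :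
    ∃ b, WLt w d b f := by
  refine ⟨(Finset.univ.sup fun j => (f j).support.sup fun u => wdeg w u + d j) + 1,
    fun j u hu => Nat.lt_succ_of_le ?_⟩
  exact (Finset.le_sup (f := fun u => wdeg w u + d j) (mem_support_iff.2 hu)).trans
    (Finset.le_sup (f := fun j => (f j).support.sup fun u => wdeg w u + d j) (Finset.mem_univ j))

theorem Hg.smul {p : A K n} (hp : ∀ u, coeff u p ≠ 0 → wdeg w u + b = c) (hf : Hg w d b f) :
    Hg w d c (p • f) := by
  intro j u hu
  rw [Pi.smul_apply, smul_eq_mul, coeff_mul] at hu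
  obtain ⟨⟨x, y⟩, hxy, hne⟩ := Finset.exists_ne_zero_of_sum_ne_zero hu
  have h1 := hp x (left_ne_zero_of_mul hne)
  have h2 := hf j y (right_ne_zero_of_mul hne)
  rw [← Finset.HasAntidiagonal.mem_antidiagonal.1 hxy, wdeg_add]
  dsimp only
  omega

theorem Hg.monomial_smul (hf : Hg w d b f) (u : Fin n →₀ ℕ) (x : K) :
    Hg w d (wdeg w u + b) ((monomial u x : A K n) • f) :=
  Hg.smul (fun v hv => by
    rw [coeff_monomial] at hv
    grind) hf

theorem cmp_monomial_smul (a : ℕ) (u : Fin n →₀ ℕ) (x : K) (f : ι → A K n) :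
    cmp w d a ((monomial u x : A K n) • f) =
      if wdeg w u ≤ a then (monomial u x : A K n) • cmp w d (a - wdeg w u) f else 0 := by
  refine vec_ext fun j v => ?_
  have key : ∀ v, u ≤ v → wdeg w v = wdeg w u + wdeg w (v - u) := fun v h => by
    rw [← wdeg_add, add_tsub_cancel_of_le h]
  rw [coeff_cut]
  split_ifs with h1 h2 h2 <;>
  simp only [Pi.smul_apply, smul_eq_mul, coeff_monomial_mul', coeff_cut, Pi.zero_apply, coeff_zero]
  all_goals
    by_cases h3 : u ≤ v
    · have := key v h3
      simp only [h3, if_true]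
      grind
    · simp [h3]

theorem gm_id : GM w d d (LinearMap.id : (ι → A K n) →ₗ[A K n] _) := fun _ _ h => h

variable {η : μ → ℕ} {φ φ' : (ι → A K n) →ₗ[A K n] (κ → A K n)}
  {ψ : (κ → A K n) →ₗ[A K n] (μ → A K n)}

theorem GM.comp (hψ : GM w e η ψ) (hφ : GM w d e φ) : GM w d η (ψ ∘ₗ φ) :=
  fun a f h => hψ a _ (hφ a f h)

theorem GM.add (h : GM w d e φ) (h' : GM w d e φ') : GM w d e (φ + φ') :=
  fun a f hf => (h a f hf).add (h' a f hf)

theorem GM.sub (h : GM w d e φ) (h' : GM w d e φ') : GM w d e (φ - φ') :=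
  fun a f hf => (h a f hf).sub (h' a f hf)

theorem GM.cmp_apply [Fintype ι] (h : GM w d e φ) (a : ℕ) (f : ι → A K n) :
    cmp w e a (φ f) = φ (cmp w d a f) := by
  obtain ⟨b, hb⟩ := exists_wlt w d f
  have hb' := hb.mono (le_max_left b (a + 1))
  conv_lhs => rw [hb'.sum_cmp, map_sum, map_sum]
  rw [Finset.sum_eq_single a]
  · exact (h a _ (hg_cmp w d a f)).cmp_eq
  · intro c _ hc
    exact (h c _ (hg_cmp w d c f)).cmp_ne hc.symm
  · intro ha
    exact absurd (Finset.mem_range.2 (by omega)) ha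

theorem GM.wlt [Fintype ι] (h : GM w d e φ) (hf : WLt w d b f) : WLt w e b (φ f) := by
  rw [hf.sum_cmp, map_sum]
  exact WLt.sum fun a ha => (h a _ (hg_cmp w d a f)).wlt (Finset.mem_range.1 ha)

theorem gm_linearCombination [Fintype ι] {g : ι → κ → A K n} (h : ∀ l, Hg w e (d l) (g l)) :
    GM w d e (Fintype.linearCombination (A K n) g) := by
  intro a f hf
  rw [Fintype.linearCombination_apply]
  exact Hg.sum fun l _ => Hg.smul (hf l) (h l)

theorem gm_of_single [Fintype ι] [DecidableEq ι] (h : ∀ l, Hg w e (d l) (φ (Pi.single l 1))) :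
    GM w d e φ := by
  have : φ = Fintype.linearCombination (A K n) fun l => φ (Pi.single l 1) := by
    refine LinearMap.pi_ext' fun l => LinearMap.ext_ring ?_
    simp [Fintype.linearCombination_apply_single]
  rw [this]
  exact gm_linearCombination h

theorem hg_single [DecidableEq ι] (l : ι) : Hg w d (d l) (Pi.single l (1 : A K n)) := by
  intro j u hu
  by_cases h : j = l
  · subst h
    rw [Pi.single_eq_same, coeff_one] at hu
    have : u = 0 := by grind
    simp [this]
  · simp [Pi.single_eq_of_ne h] at hu

end Basic

section Submodules

variable {w : Fin n → ℕ} {d : ι → ℕ} {e : κ → ℕ} {M N : Submodule (A K n) (ι → A K n)}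
  {φ : (ι → A K n) →ₗ[A K n] (κ → A K n)}

theorem gr_top : Gr w d (⊤ : Submodule (A K n) (ι → A K n)) := fun _ _ _ => trivial

theorem Gr.inf (hM : Gr w d M) (hN : Gr w d N) : Gr w d (M ⊓ N) :=
  fun f hf a => ⟨hM f hf.1 a, hN f hf.2 a⟩

theorem GM.gr_comap [Fintype ι] (h : GM w d e φ) {P : Submodule (A K n) (κ → A K n)}
    (hP : Gr w e P) : Gr w d (P.comap φ) := fun f hf a => by
  rw [Submodule.mem_comap, ← h.cmp_apply]
  exact hP _ hf a

theorem GM.gr_ker [Fintype ι] (h : GM w d e φ) : Gr w d (LinearMap.ker φ) := fun f hf a => by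
  rw [LinearMap.mem_ker, ← h.cmp_apply, LinearMap.mem_ker.1 hf, map_zero]

theorem GM.gr_map [Fintype ι] (h : GM w d e φ) (hM : Gr w d M) : Gr w e (M.map φ) := by
  rintro _ ⟨f, hf, rfl⟩ a
  exact ⟨cmp w d a f, hM f hf a, (h.cmp_apply a f).symm⟩

theorem gr_span {S : Set (ι → A K n)} (h : ∀ s ∈ S, ∃ a, Hg w d a s) :
    Gr w d (Submodule.span (A K n) S) := by
  intro f hf
  induction hf using Submodule.span_induction with
  | mem x hx =>
    intro a
    obtain ⟨b, hb⟩ := h x hx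
    by_cases hab : a = b
    · rw [hab, hb.cmp_eq]
      exact Submodule.subset_span hx
    · rw [hb.cmp_ne hab]
      exact zero_mem _
  | zero => simp
  | add x y _ _ hx hy =>
    intro a
    rw [map_add]
    exact add_mem (hx a) (hy a)
  | smul r x _ hx =>
    induction r using MvPolynomial.induction_on' with
    | monomial u c =>
      intro a
      rw [cmp_monomial_smul]
      split_ifs
      · exact Submodule.smul_mem _ _ (hx _)
      · exact zero_mem _
    | add p q hp hq =>
      intro a
      rw [add_smul, map_add]
      exact add_mem (hp a) (hq a)

theorem Gr.exists_hg_of_mem_map [Fintype ι] (hM : Gr w d M) (h : GM w d e φ) {a : ℕ}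
    {y : κ → A K n} (hy : y ∈ M.map φ) (hya : Hg w e a y) : ∃ x ∈ M, Hg w d a x ∧ φ x = y := by
  obtain ⟨x, hx, rfl⟩ := hy
  exact ⟨cmp w d a x, hM x hx a, hg_cmp w d a x, by rw [← h.cmp_apply, hya.cmp_eq]⟩

theorem Gr.mem_of_cmp [Fintype ι] {x : ι → A K n} (h : ∀ a, cmp w d a x ∈ M) : x ∈ M := by
  obtain ⟨b, hb⟩ := exists_wlt w d x
  rw [hb.sum_cmp]
  exact sum_mem fun a _ => h a

theorem Gr.le_of_hg [Fintype ι] (hM : Gr w d M) (h : ∀ a, ∀ x ∈ M, Hg w d a x → x ∈ N) :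
    M ≤ N := fun x hx =>
  Gr.mem_of_cmp fun a => h a _ (hM x hx a) (hg_cmp w d a x)

theorem exists_gm_lift [Fintype ι] [Fintype μ] {η : μ → ℕ} (hM : Gr w d M) (h : GM w d e φ)
    {ψ : (μ → A K n) →ₗ[A K n] (κ → A K n)} (hψ : GM w η e ψ)
    (hr : LinearMap.range ψ ≤ M.map φ) :
    ∃ Ψ : (μ → A K n) →ₗ[A K n] (ι → A K n), GM w η d Ψ ∧ LinearMap.range Ψ ≤ M ∧
      φ ∘ₗ Ψ = ψ := by
  classical
  have := fun l => hM.exists_hg_of_mem_map h (hr ⟨Pi.single l 1, rfl⟩) (hψ _ _ (hg_single l))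
  choose x hxM hx hxe using this
  refine ⟨Fintype.linearCombination (A K n) x, gm_linearCombination hx, ?_, ?_⟩
  · rw [Fintype.range_linearCombination, Submodule.span_le]
    rintro _ ⟨l, rfl⟩
    exact hxM l
  · refine LinearMap.pi_ext' fun l => LinearMap.ext_ring ?_
    simp [Fintype.linearCombination_apply_single, hxe]

end Submodules

end Graded

end CregPaper

namespace CregPaper

section SumMaps

variable {K : Type*} [Field K] {n : ℕ} {κ μ : Type}

open MvPolynomial

/-- The free module on `κ` as the first summand of the free module on `κ ⊕ μ`. -/
noncomputable def inlMap : (κ → A K n) →ₗ[A K n] (κ ⊕ μ → A K n) :=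
  LinearMap.pi (Sum.elim (fun l => LinearMap.proj l) fun _ => 0)

/-- The free module on `μ` as the second summand of the free module on `κ ⊕ μ`. -/
noncomputable def inrMap : (μ → A K n) →ₗ[A K n] (κ ⊕ μ → A K n) :=
  LinearMap.pi (Sum.elim (fun _ => 0) fun l => LinearMap.proj l)

/-- The projection onto the first summand. -/
noncomputable def fstMap : (κ ⊕ μ → A K n) →ₗ[A K n] (κ → A K n) :=
  LinearMap.funLeft _ _ Sum.inl

/-- The projection onto the second summand. -/
noncomputable def sndMap : (κ ⊕ μ → A K n) →ₗ[A K n] (μ → A K n) :=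
  LinearMap.funLeft _ _ Sum.inr

variable (x : κ → A K n) (y : μ → A K n) (z : κ ⊕ μ → A K n)

@[simp] theorem fst_inl : fstMap (inlMap x : κ ⊕ μ → A K n) = x := rfl

@[simp] theorem snd_inl : sndMap (inlMap x : κ ⊕ μ → A K n) = 0 := rfl

@[simp] theorem fst_inr : fstMap (inrMap y : κ ⊕ μ → A K n) = 0 := rfl

@[simp] theorem snd_inr : sndMap (inrMap y : κ ⊕ μ → A K n) = y := rfl

theorem inl_fst_add_inr_snd : inlMap (fstMap z) + inrMap (sndMap z) = z := by
  ext1 (j | j)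
  · exact add_zero _
  · exact zero_add _

variable {w : Fin n → ℕ} {e : κ → ℕ} {η : μ → ℕ}

theorem gm_inl : GM w e (Sum.elim e η) (inlMap : (κ → A K n) →ₗ[A K n] (κ ⊕ μ → A K n)) := by
  rintro a f hf (j | j) u hu
  · exact hf j u hu
  · simp [inlMap] at hu

theorem gm_inr : GM w η (Sum.elim e η) (inrMap : (μ → A K n) →ₗ[A K n] (κ ⊕ μ → A K n)) := by
  rintro a f hf (j | j) u hu
  · simp [inrMap] at hu
  · exact hf j u hu

theorem gm_fst : GM w (Sum.elim e η) e (fstMap : (κ ⊕ μ → A K n) →ₗ[A K n] (κ → A K n)) :=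
  fun _ _ hf j u hu => hf (Sum.inl j) u hu

theorem gm_snd : GM w (Sum.elim e η) η (sndMap : (κ ⊕ μ → A K n) →ₗ[A K n] (μ → A K n)) :=
  fun _ _ hf j u hu => hf (Sum.inr j) u hu

end SumMaps

section Regularity

variable {K : Type*} [Field K] {n : ℕ} {ι κ μ : Type} [Fintype ι] [Fintype κ] [Fintype μ]

open MvPolynomial

/-- `M` has a graded free presentation, continued for `s` steps, whose shifts in homological
degree `i` are at most `i + r`. -/
def Reg : ℕ → ∀ {ι : Type} [Fintype ι], (ι → ℕ) → Submodule (A K n) (ι → A K n) → ℕ → Prop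
  | 0, _, _, _, _, _ => True
  | s + 1, ι, _, d, M, r => ∃ (κ : Type) (_ : Fintype κ) (e : κ → ℕ)
      (φ : (κ → A K n) →ₗ[A K n] (ι → A K n)), GM 1 e d φ ∧ (∀ l, e l ≤ r) ∧
        LinearMap.range φ = M ∧ Reg s e (LinearMap.ker φ) (r + 1)

variable {d : ι → ℕ} {e : κ → ℕ} {M N U V : Submodule (A K n) (ι → A K n)} {r r' s : ℕ}

theorem Reg.mono (hr : r ≤ r') (h : Reg s d M r) : Reg s d M r' := by
  induction s generalizing ι r r' with
  | zero => trivial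
  | succ s ih =>
    obtain ⟨κ, _, e, φ, hφ, he, hM, hk⟩ := h
    exact ⟨κ, _, e, φ, hφ, fun l => (he l).trans hr, hM, ih (by omega) hk⟩

theorem Reg.of_succ (h : Reg (s + 1) d M r) : Reg s d M r := by
  induction s generalizing ι r with
  | zero => trivial
  | succ s ih =>
    obtain ⟨κ, _, e, φ, hφ, he, hM, hk⟩ := h
    exact ⟨κ, _, e, φ, hφ, he, hM, ih hk⟩

theorem reg_bot : Reg s d (⊥ : Submodule (A K n) (ι → A K n)) r := by
  induction s generalizing ι r with
  | zero => trivial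
  | succ s ih =>
    refine ⟨Empty, inferInstance, fun _ => 0, 0, fun a f _ => hg_zero, nofun, ?_, ?_⟩
    · exact LinearMap.range_zero
    · have : LinearMap.ker (0 : (Empty → A K n) →ₗ[A K n] (ι → A K n)) = ⊥ :=
        Submodule.eq_bot_of_subsingleton
      rw [this]
      exact ih

theorem reg_top (h : ∀ j, d j ≤ r) : Reg s d (⊤ : Submodule (A K n) (ι → A K n)) r := by
  cases s with
  | zero => trivial
  | succ s =>
    refine ⟨ι, inferInstance, d, LinearMap.id, gm_id, h, LinearMap.range_id, ?_⟩
    rw [LinearMap.ker_id]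
    exact reg_bot

theorem Reg.map_of_injOn {f : (ι → A K n) →ₗ[A K n] (κ → A K n)} (hf : GM 1 d e f)
    (hM : M ⊓ LinearMap.ker f = ⊥) (h : Reg s d M r) : Reg s e (M.map f) r := by
  cases s with
  | zero => trivial
  | succ s =>
    obtain ⟨κ', _, e', φ, hφ, he, rfl, hk⟩ := h
    refine ⟨κ', inferInstance, e', f ∘ₗ φ, hf.comp hφ, he, LinearMap.range_comp _ _, ?_⟩
    convert hk using 1
    refine le_antisymm (fun x hx => ?_) (LinearMap.ker_le_ker_comp _ _)
    have : φ x ∈ LinearMap.range φ ⊓ LinearMap.ker f := ⟨⟨x, rfl⟩, hx⟩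
    rwa [hM] at this

/-- Regularity of the middle term of a short exact sequence. -/
theorem Reg.of_ker_of_map {f : (ι → A K n) →ₗ[A K n] (κ → A K n)} (hf : GM 1 d e f)
    (hM : Gr 1 d M) (hk : Reg s d (M ⊓ LinearMap.ker f) r) (hm : Reg s e (M.map f) r) :
    Reg s d M r := by
  induction s generalizing ι κ r with
  | zero => trivial
  | succ s ih =>
    obtain ⟨κ₁, _, e₁, φ₁, hφ₁, he₁, hr₁, hk₁⟩ := hk
    obtain ⟨κ₂, _, e₂, φ₂, hφ₂, he₂, hr₂, hk₂⟩ := hm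
    obtain ⟨Ψ, hΨ, hΨr, hfΨ⟩ := exists_gm_lift hM hf hφ₂ hr₂.le
    have hfΨ' : ∀ y, f (Ψ y) = φ₂ y := fun y => LinearMap.congr_fun hfΨ y
    have hΨM : ∀ y, Ψ y ∈ M := fun y => hΨr ⟨y, rfl⟩
    have hφM : ∀ x, φ₁ x ∈ M ⊓ LinearMap.ker f := fun x => hr₁ ▸ ⟨x, rfl⟩
    have hφ0 : ∀ x, f (φ₁ x) = 0 := fun x => (hφM x).2
    let Φ : (κ₁ ⊕ κ₂ → A K n) →ₗ[A K n] (ι → A K n) := φ₁ ∘ₗ fstMap + Ψ ∘ₗ sndMap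
    have hΦ : ∀ z, Φ z = φ₁ (fstMap z) + Ψ (sndMap z) := fun z => rfl
    have hΦg : GM 1 (Sum.elim e₁ e₂) d Φ := (hφ₁.comp gm_fst).add (hΨ.comp gm_snd)
    refine ⟨κ₁ ⊕ κ₂, inferInstance, Sum.elim e₁ e₂, Φ, hΦg, ?_, le_antisymm ?_ ?_, ?_⟩
    · rintro (l | l)
      exacts [he₁ l, he₂ l]
    · rintro _ ⟨z, rfl⟩
      exact add_mem (hφM _).1 (hΨM _)
    · intro x hx
      obtain ⟨y, hy⟩ : f x ∈ LinearMap.range φ₂ := hr₂ ▸ ⟨x, hx, rfl⟩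
      obtain ⟨z, hz⟩ : x - Ψ y ∈ LinearMap.range φ₁ := hr₁ ▸
        ⟨sub_mem hx (hΨM y), by simp [hfΨ', hy]⟩
      exact ⟨inlMap z + inrMap y, by simp [hΦ, hz]⟩
    · refine ih (f := sndMap) gm_snd hΦg.gr_ker ?_ ?_
      · have : LinearMap.ker Φ ⊓ LinearMap.ker sndMap = (LinearMap.ker φ₁).map inlMap := by
          refine le_antisymm ?_ ?_
          · rintro z ⟨hz, hz2⟩
            have hz2' : sndMap z = 0 := hz2
            refine ⟨fstMap z, ?_, ?_⟩
            · have hz' : Φ z = 0 := hz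
              rw [hΦ, hz2', map_zero, add_zero] at hz'
              exact hz'
            · conv_rhs => rw [← inl_fst_add_inr_snd z, hz2', map_zero, add_zero]
          · rintro _ ⟨x, hx, rfl⟩
            have hx' : φ₁ x = 0 := hx
            exact ⟨by simp [hΦ, hx'], by simp⟩
        rw [this]
        refine Reg.map_of_injOn gm_inl ?_ hk₁
        refine (Submodule.eq_bot_iff _).2 fun x hx => ?_
        have : fstMap (inlMap x : κ₁ ⊕ κ₂ → A K n) = fstMap 0 := congrArg _ hx.2
        simpa using this
      · have : (LinearMap.ker Φ).map sndMap = LinearMap.ker φ₂ := by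
          refine le_antisymm ?_ ?_
          · rintro _ ⟨z, hz, rfl⟩
            have hz' : f (Φ z) = 0 := by rw [LinearMap.mem_ker.1 hz, map_zero]
            simpa [hΦ, hφ0, hfΨ'] using hz'
          · intro y hy
            obtain ⟨x, hx⟩ : Ψ y ∈ LinearMap.range φ₁ := hr₁ ▸
              ⟨hΨM y, by simpa [hfΨ'] using hy⟩
            exact ⟨inlMap (-x) + inrMap y, by simp [hΦ, hx], by simp⟩
        rw [this]
        exact hk₂

/-- Regularity of the last term of a short exact sequence. -/
theorem Reg.map {f : (ι → A K n) →ₗ[A K n] (κ → A K n)} (hf : GM 1 d e f)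
    (hM : Reg (s + 1) d M r) (hk : Reg s d (M ⊓ LinearMap.ker f) (r + 1)) :
    Reg (s + 1) e (M.map f) r := by
  obtain ⟨κ', _, e', φ, hφ, he, rfl, hk'⟩ := hM
  refine ⟨κ', inferInstance, e', f ∘ₗ φ, hf.comp hφ, he, LinearMap.range_comp _ _, ?_⟩
  refine Reg.of_ker_of_map hφ (hf.comp hφ).gr_ker ?_ ?_
  · rwa [inf_eq_right.2 (LinearMap.ker_le_ker_comp _ _)]
  · convert hk using 1
    refine le_antisymm ?_ ?_
    · rintro _ ⟨x, hx, rfl⟩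
      exact ⟨⟨x, rfl⟩, hx⟩
    · rintro _ ⟨⟨x, rfl⟩, hx⟩
      exact ⟨x, hx, rfl⟩

/-- Regularity passes to graded direct summands. -/
theorem Reg.retract {P : Submodule (A K n) (κ → A K n)} {f : (ι → A K n) →ₗ[A K n] (κ → A K n)}
    {p : (κ → A K n) →ₗ[A K n] (ι → A K n)} (hf : GM 1 d e f) (hp : GM 1 e d p)
    (hfM : ∀ x ∈ M, f x ∈ P) (hpP : ∀ y ∈ P, p y ∈ M) (hpf : ∀ x ∈ M, p (f x) = x)
    (h : Reg s e P r) : Reg s d M r := by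
  induction s generalizing ι κ r with
  | zero => trivial
  | succ s ih =>
    have hP := h.of_succ
    obtain ⟨κ', _, e', φ, hφ, he, rfl, hk⟩ := h
    refine ⟨κ', inferInstance, e', p ∘ₗ φ, hp.comp hφ, he, ?_, ?_⟩
    · refine le_antisymm ?_ ?_
      · rintro _ ⟨x, rfl⟩
        exact hpP _ ⟨x, rfl⟩
      · intro x hx
        obtain ⟨y, hy⟩ := hfM x hx
        exact ⟨y, by simp [hy, hpf x hx]⟩
    · refine Reg.of_ker_of_map hφ (hp.comp hφ).gr_ker ?_ ?_
      · rwa [inf_eq_right.2 (LinearMap.ker_le_ker_comp _ _)]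
      · refine Reg.mono (Nat.le_succ r) (ih (f := LinearMap.id) (p := LinearMap.id - f ∘ₗ p)
          gm_id (gm_id.sub (hf.comp hp)) ?_ ?_ ?_ hP)
        · rintro _ ⟨x, _, rfl⟩
          exact ⟨x, rfl⟩
        · rintro y ⟨x, rfl⟩
          obtain ⟨z, hz⟩ := hfM _ (hpP _ ⟨x, rfl⟩)
          refine ⟨x - z, ?_, ?_⟩
          · simp [hz, hpf _ (hpP _ ⟨x, rfl⟩)]
          · simp [hz]
        · rintro _ ⟨x, hx, rfl⟩
          have : p (φ x) = 0 := hx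
          simp [this]

theorem Reg.sup (hUg : Gr 1 d U) (hVg : Gr 1 d V) (hU : Reg (s + 1) d U r)
    (hV : Reg (s + 1) d V r) (hUV : Reg s d (U ⊓ V) (r + 1)) : Reg (s + 1) d (U ⊔ V) r := by
  let P : Submodule (A K n) (ι ⊕ ι → A K n) := U.comap fstMap ⊓ V.comap sndMap
  have hP : Gr 1 (Sum.elim d d) P := (gm_fst.gr_comap hUg).inf (gm_snd.gr_comap hVg)
  have hPr : Reg (s + 1) (Sum.elim d d) P r := by
    refine Reg.of_ker_of_map (f := sndMap) gm_snd hP ?_ ?_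
    · have : P ⊓ LinearMap.ker sndMap = U.map inlMap := by
        refine le_antisymm ?_ ?_
        · rintro z ⟨hz, hz2⟩
          refine ⟨fstMap z, hz.1, ?_⟩
          have hz2' : sndMap z = 0 := hz2
          conv_rhs => rw [← inl_fst_add_inr_snd z, hz2', map_zero, add_zero]
        · rintro _ ⟨x, hx, rfl⟩
          exact ⟨⟨by simpa using hx, by simp⟩, by simp⟩
      rw [this]
      refine Reg.map_of_injOn gm_inl ?_ hU
      refine (Submodule.eq_bot_iff _).2 fun x hx => ?_
      have : fstMap (inlMap x : ι ⊕ ι → A K n) = fstMap 0 := congrArg _ hx.2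
      simpa using this
    · have : P.map sndMap = V := by
        refine le_antisymm ?_ ?_
        · rintro _ ⟨z, hz, rfl⟩
          exact hz.2
        · intro x hx
          exact ⟨inrMap x, ⟨by simp, by simpa using hx⟩, by simp⟩
      rwa [this]
  have hadd : U ⊔ V = P.map (fstMap + sndMap) := by
    refine le_antisymm (sup_le ?_ ?_) ?_
    · intro x hx
      exact ⟨inlMap x, ⟨by simpa using hx, by simp⟩, by simp⟩
    · intro x hx
      exact ⟨inrMap x, ⟨by simp, by simpa using hx⟩, by simp⟩
    · rintro _ ⟨z, hz, rfl⟩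
      exact Submodule.add_mem_sup hz.1 hz.2
  rw [hadd]
  refine hPr.map (gm_fst.add gm_snd) ?_
  have : P ⊓ LinearMap.ker (fstMap + sndMap) = (U ⊓ V).map (inlMap - inrMap) := by
    refine le_antisymm ?_ ?_
    · rintro z ⟨hz, hz2⟩
      have hz2' : fstMap z + sndMap z = 0 := hz2
      have hs : sndMap z = - fstMap z := (neg_eq_of_add_eq_zero_right hz2').symm
      refine ⟨fstMap z, ⟨hz.1, ?_⟩, ?_⟩
      · rw [← neg_neg (fstMap z), ← hs]
        exact neg_mem hz.2
      · conv_rhs => rw [← inl_fst_add_inr_snd z, hs]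
        simp [sub_eq_add_neg]
    · rintro _ ⟨x, hx, rfl⟩
      refine ⟨⟨by simpa using hx.1, by simpa using hx.2⟩, by simp⟩
  rw [this]
  refine Reg.map_of_injOn (gm_inl.sub gm_inr) ?_ hUV
  refine (Submodule.eq_bot_iff _).2 fun x hx => ?_
  have : fstMap ((inlMap - inrMap : _ →ₗ[A K n] (ι ⊕ ι → A K n)) x) = fstMap 0 := congrArg _ hx.2
  simpa using this

end Regularity

end CregPaper

namespace CregPaper

section MinimalPresentations

variable {K : Type*} [Field K] {n : ℕ} {ι κ ι' κ' : Type}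
  [Fintype κ] [Fintype κ']

open MvPolynomial

/-- All coordinates of all elements of `N` have zero constant term. -/
def MMin {ι : Type} (N : Submodule (A K n) (ι → A K n)) : Prop :=
  ∀ x ∈ N, ∀ l, x l ∈ mIdeal K n

theorem mem_mIdeal {p : A K n} : p ∈ mIdeal K n ↔ coeff 0 p = 0 := Iff.rfl

variable {d : ι → ℕ} {d' : ι' → ℕ} {e : κ → ℕ} {e' : κ' → ℕ}

theorem isNilpotent_of_mem_mIdeal {η : Module.End (A K n) (κ → A K n)} (hη : GM 1 e e η)
    (hm : ∀ x l, η x l ∈ mIdeal K n) : IsNilpotent η := by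
  classical
  have hs : ∀ l l', e l ≤ e l' → η (Pi.single l 1) l' = 0 := by
    intro l l' hl
    ext u
    by_contra hu
    have h1 := hη _ _ (hg_single l) l' u hu
    obtain rfl : u = 0 := eq_zero_of_wdeg_one (by omega)
    exact hu (mem_mIdeal.1 (hm _ _))
  have hV : ∀ c, ∀ f : κ → A K n, (∀ l, c ≤ e l → f l = 0) → (η ^ c) f = 0 := by
    intro c
    induction c with
    | zero => exact fun f hf => funext fun l => hf l (Nat.zero_le _)
    | succ c ih =>
      intro f hf
      rw [pow_succ, Module.End.mul_apply]
      refine ih _ fun l' hl' => ?_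
      have hf' : f = ∑ l, f l • (Pi.single l 1 : κ → A K n) := pi_eq_sum_univ' f
      rw [hf', map_sum, Finset.sum_apply]
      refine Finset.sum_eq_zero fun l _ => ?_
      rw [map_smul, Pi.smul_apply]
      by_cases hl : e l ≤ e l'
      · rw [hs l l' hl, smul_zero]
      · rw [hf l (by omega), zero_smul]
  refine ⟨Finset.univ.sup e + 1, LinearMap.ext fun f => hV _ f fun l hl => ?_⟩
  have := Finset.le_sup (f := e) (Finset.mem_univ l)
  omega

theorem exists_gm_inverse {σ : Module.End (A K n) (κ → A K n)} (hσ : GM 1 e e σ)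
    (hm : ∀ x l, (σ x - x) l ∈ mIdeal K n) :
    ∃ θ : Module.End (A K n) (κ → A K n), GM 1 e e θ ∧ (∀ x, θ (σ x) = x) ∧
      ∀ x, σ (θ x) = x := by
  have hu : IsUnit σ := by
    have := (isNilpotent_of_mem_mIdeal (η := σ - 1) (hσ.sub gm_id) hm).isUnit_one_add
    rwa [add_sub_cancel] at this
  obtain ⟨u, rfl⟩ := hu
  have h1 : ∀ x, (↑u⁻¹ : Module.End (A K n) (κ → A K n)) (u.1 x) = x := fun x => by
    rw [← Module.End.mul_apply, Units.inv_mul, Module.End.one_apply]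
  have h2 : ∀ x, u.1 ((↑u⁻¹ : Module.End (A K n) (κ → A K n)) x) = x := fun x => by
    rw [← Module.End.mul_apply, Units.mul_inv, Module.End.one_apply]
  refine ⟨↑u⁻¹, fun a f hf => ?_, h1, h2⟩
  have : cmp 1 e a ((↑u⁻¹ : Module.End (A K n) (κ → A K n)) f) =
      (↑u⁻¹ : Module.End (A K n) (κ → A K n)) f := by
    rw [← h1 (cmp 1 e a _), ← hσ.cmp_apply, h2, hf.cmp_eq]
  rw [← this]
  exact hg_cmp _ _ _ _

/-- A graded retraction between the images of two graded maps lifts to the sources when the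
second map is a minimal presentation. -/
theorem exists_retract_lift {φ : (κ → A K n) →ₗ[A K n] (ι → A K n)}
    {ψ : (κ' → A K n) →ₗ[A K n] (ι' → A K n)} {a : (ι' → A K n) →ₗ[A K n] (ι → A K n)}
    {p : (ι → A K n) →ₗ[A K n] (ι' → A K n)} (hφ : GM 1 e d φ) (hψ : GM 1 e' d' ψ)
    (ha : GM 1 d' d a) (hp : GM 1 d d' p) (haψ : ∀ x, a (ψ x) ∈ LinearMap.range φ)
    (hpφ : ∀ x, p (φ x) ∈ LinearMap.range ψ) (hpa : ∀ x, p (a (ψ x)) = ψ x)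
    (hm : MMin (LinearMap.ker ψ)) :
    ∃ (α : (κ' → A K n) →ₗ[A K n] (κ → A K n)) (β : (κ → A K n) →ₗ[A K n] (κ' → A K n)),
      GM 1 e' e α ∧ GM 1 e e' β ∧ (∀ x, φ (α x) = a (ψ x)) ∧ (∀ x, ψ (β x) = p (φ x)) ∧
        ∀ x, β (α x) = x := by
  obtain ⟨α, hα, -, hα'⟩ := exists_gm_lift (M := ⊤) gr_top hφ (ha.comp hψ) (by
    rintro _ ⟨x, rfl⟩
    rw [← LinearMap.range_eq_map]
    exact haψ x)
  obtain ⟨β, hβ, -, hβ'⟩ := exists_gm_lift (M := ⊤) gr_top hψ (hp.comp hφ) (by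
    rintro _ ⟨x, rfl⟩
    rw [← LinearMap.range_eq_map]
    exact hpφ x)
  have hα1 : ∀ x, φ (α x) = a (ψ x) := LinearMap.congr_fun hα'
  have hβ1 : ∀ x, ψ (β x) = p (φ x) := LinearMap.congr_fun hβ'
  have hψσ : ∀ x, ψ (β (α x)) = ψ x := fun x => by rw [hβ1, hα1, hpa]
  obtain ⟨θ, hθ, h1, h2⟩ := exists_gm_inverse (σ := β ∘ₗ α) (hβ.comp hα) fun x l =>
    hm _ (by rw [LinearMap.mem_ker, map_sub, LinearMap.comp_apply, hψσ, sub_self]) l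
  refine ⟨α, θ ∘ₗ β, hα, hθ.comp hβ, hα1, fun x => ?_, h1⟩
  rw [← hβ1, LinearMap.comp_apply, ← hψσ (θ (β x))]
  exact congrArg ψ (h2 (β x))

theorem Reg.of_minimal [Fintype ι] {t r : ℕ} {M : Submodule (A K n) (ι → A K n)}
    {ψ : (κ → A K n) →ₗ[A K n] (ι → A K n)} (h : Reg (t + 1) d M r) (hψ : GM 1 e d ψ)
    (hr : LinearMap.range ψ = M) (hm : MMin (LinearMap.ker ψ)) :
    (∀ l, e l ≤ r) ∧ Reg t e (LinearMap.ker ψ) (r + 1) := by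
  classical
  obtain ⟨κ₁, _, e₁, φ, hφ, he, hr', hk⟩ := h
  have hr1 : LinearMap.range φ = LinearMap.range ψ := hr'.trans hr.symm
  obtain ⟨α, β, hα, hβ, hα1, hβ1, hβα⟩ := exists_retract_lift hφ hψ gm_id gm_id
    (fun x => hr1 ▸ ⟨x, rfl⟩) (fun x => hr1 ▸ ⟨x, rfl⟩) (fun x => rfl) hm
  refine ⟨fun l => ?_, Reg.retract hα hβ ?_ ?_ (fun x _ => hβα x) hk⟩
  · have : ∃ j, β (Pi.single j 1) l ≠ 0 := by
      by_contra! hc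
      have h0 : LinearMap.proj l ∘ₗ β = 0 :=
        LinearMap.pi_ext' fun j => LinearMap.ext_ring (by simpa using hc j)
      have h1 := LinearMap.congr_fun h0 (α (Pi.single l 1))
      rw [LinearMap.comp_apply, hβα] at h1
      simp at h1
    obtain ⟨j, hj⟩ := this
    obtain ⟨u, hu⟩ := MvPolynomial.ne_zero_iff.1 hj
    have h1 := hβ _ _ (hg_single j) l u hu
    have h2 := he j
    omega
  · intro x hx
    rw [LinearMap.mem_ker, hα1, LinearMap.mem_ker.1 hx, map_zero]
  · intro x hx
    rw [LinearMap.mem_ker, hβ1, LinearMap.mem_ker.1 hx, map_zero]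

end MinimalPresentations

end CregPaper

namespace CregPaper

section Monomial

variable {K : Type*} [Field K] {n : ℕ} {ι κ : Type}

open MvPolynomial

/-- The submodule of vectors all of whose terms satisfy the upward closed condition `P`. -/
def monoSub (K : Type*) [Field K] (P : ι → (Fin n →₀ ℕ) → Prop)
    (hP : ∀ j u v, P j u → P j (v + u)) : Submodule (A K n) (ι → A K n) where
  carrier := {f | ∀ j u, coeff u (f j) ≠ 0 → P j u}
  add_mem' := by
    intro f g hf hg j u hu
    by_contra hc
    have h1 := not_imp_comm.1 (hf j u) hc
    have h2 := not_imp_comm.1 (hg j u) hc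
    simp [h1, h2] at hu
  zero_mem' := by intro j u hu; simp at hu
  smul_mem' := by
    intro p f hf j u hu
    rw [Pi.smul_apply, smul_eq_mul, coeff_mul] at hu
    obtain ⟨⟨x, y⟩, hxy, hne⟩ := Finset.exists_ne_zero_of_sum_ne_zero hu
    rw [← Finset.HasAntidiagonal.mem_antidiagonal.1 hxy]
    exact hP _ _ _ (hf j y (right_ne_zero_of_mul hne))

variable {P Q R : ι → (Fin n →₀ ℕ) → Prop} {hP : ∀ j u v, P j u → P j (v + u)}
  {hQ : ∀ j u v, Q j u → Q j (v + u)} {hR : ∀ j u v, R j u → R j (v + u)}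
  {d : ι → ℕ} {e : κ → ℕ}

theorem mem_monoSub {f : ι → A K n} :
    f ∈ monoSub K P hP ↔ ∀ j u, coeff u (f j) ≠ 0 → P j u := Iff.rfl

theorem gr_monoSub {w : Fin n → ℕ} : Gr w d (monoSub K P hP) := by
  intro f hf a j u hu
  rw [coeff_cut] at hu
  exact hf j u (by grind)

theorem monoSub_inf (h : ∀ j u, R j u ↔ P j u ∧ Q j u) :
    monoSub K P hP ⊓ monoSub K Q hQ = monoSub K R hR := by
  ext f
  simp only [Submodule.mem_inf, mem_monoSub, h]
  grind

theorem monoSub_sup (h : ∀ j u, R j u ↔ P j u ∨ Q j u) :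
    monoSub K P hP ⊔ monoSub K Q hQ = monoSub K R hR := by
  refine le_antisymm (sup_le ?_ ?_) fun f hf => ?_
  · exact fun f hf j u hu => (h j u).2 (Or.inl (hf j u hu))
  · exact fun f hf j u hu => (h j u).2 (Or.inr (hf j u hu))
  · have : f = cut P f + (f - cut P f) := (add_sub_cancel _ _).symm
    rw [this]
    refine Submodule.add_mem_sup (fun j u hu => ?_) fun j u hu => ?_
    · rw [coeff_cut] at hu
      grind
    · rw [Pi.sub_apply, coeff_sub, coeff_cut] at hu
      have h1 := hf j u
      have h2 := h j u
      by_cases h3 : P j u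
      · simp [h3] at hu
      · simp only [h3, if_false, sub_zero] at hu
        exact (h2.1 (h1 hu)).resolve_left h3

/-- Multiplication by a variable. -/
noncomputable def mulX (s : Fin n) : (ι → A K n) →ₗ[A K n] (ι → A K n) :=
  (X s : A K n) • LinearMap.id

theorem mulX_apply (s : Fin n) (f : ι → A K n) (j : ι) : mulX s f j = X s * f j := rfl

theorem ker_mulX (s : Fin n) :
    LinearMap.ker (mulX s : (ι → A K n) →ₗ[A K n] (ι → A K n)) = ⊥ := by
  refine (Submodule.eq_bot_iff _).2 fun f hf => funext fun j => ?_
  have := congrFun (LinearMap.mem_ker.1 hf) j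
  rw [mulX_apply] at this
  exact (mul_eq_zero.1 this).resolve_left (X_ne_zero s)

theorem gm_mulX (s : Fin n) :
    GM 1 (fun j => d j + 1) d (mulX s : (ι → A K n) →ₗ[A K n] (ι → A K n)) := by
  intro a f hf j u hu
  rw [mulX_apply, mul_comm, coeff_mul_X'] at hu
  have hs : s ∈ u.support := by grind
  rw [if_pos hs] at hu
  have h1 := hf j _ hu
  have h2 : Finsupp.single s 1 ≤ u := by
    rw [Finsupp.single_le_iff]
    exact Nat.one_le_iff_ne_zero.2 (Finsupp.mem_support_iff.1 hs)
  have h3 : wdeg 1 u = wdeg 1 (u - Finsupp.single s 1) + 1 := by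
    conv_lhs => rw [← tsub_add_cancel_of_le h2, wdeg_add]
    simp [wdeg]
  dsimp only at h1
  omega

theorem map_mulX_monoSub (s : Fin n) (h : ∀ j u, Q j u ↔ 1 ≤ u s ∧ P j (u - Finsupp.single s 1)) :
    (monoSub K P hP).map (mulX s) = monoSub K Q hQ := by
  refine le_antisymm ?_ fun f hf => ?_
  · rintro _ ⟨f, hf, rfl⟩ j u hu
    rw [mulX_apply, mul_comm, coeff_mul_X'] at hu
    have hs : s ∈ u.support := by grind
    rw [if_pos hs] at hu
    exact (h j u).2 ⟨Nat.one_le_iff_ne_zero.2 (Finsupp.mem_support_iff.1 hs), hf j _ hu⟩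
  · refine ⟨fun j => divMonomial (f j) (Finsupp.single s 1), fun j u hu => ?_,
      vec_ext fun j u => ?_⟩
    · rw [coeff_divMonomial] at hu
      have := ((h j _).1 (hf j _ hu)).2
      rwa [add_tsub_cancel_left] at this
    · rw [mulX_apply, mul_comm, coeff_mul_X']
      split_ifs with hs
      · rw [coeff_divMonomial, add_tsub_cancel_of_le]
        rw [Finsupp.single_le_iff]
        exact Nat.one_le_iff_ne_zero.2 (Finsupp.mem_support_iff.1 hs)
      · by_contra hu
        have := ((h j _).1 (hf j _ (Ne.symm hu))).1
        exact hs (Finsupp.mem_support_iff.2 (by omega))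

open Classical in
/-- Extension by zero from a subset of the basis. -/
noncomputable def extMap (J : ι → Prop) : ({j // J j} → A K n) →ₗ[A K n] (ι → A K n) where
  toFun f j := if h : J j then f ⟨j, h⟩ else 0
  map_add' f g := by ext1 j; by_cases h : J j <;> simp [h]
  map_smul' c f := by ext1 j; by_cases h : J j <;> simp [h]

theorem extMap_of {J : ι → Prop} {j : ι} (h : J j) (f : {j // J j} → A K n) :
    extMap J f j = f ⟨j, h⟩ := dif_pos h

theorem extMap_of_not {J : ι → Prop} {j : ι} (h : ¬ J j) (f : {j // J j} → A K n) :
    extMap J f j = 0 := dif_neg h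

theorem gm_extMap {w : Fin n → ℕ} {J : ι → Prop} :
    GM w (fun j : {j // J j} => d j) d (extMap J : _ →ₗ[A K n] (ι → A K n)) := by
  intro a f hf j u hu
  by_cases h : J j
  · rw [extMap_of h] at hu
    exact hf ⟨j, h⟩ u hu
  · simp [extMap_of_not h] at hu

theorem ker_extMap {J : ι → Prop} :
    LinearMap.ker (extMap J : _ →ₗ[A K n] (ι → A K n)) = ⊥ := by
  refine (Submodule.eq_bot_iff _).2 fun f hf => funext fun j => ?_
  rw [← extMap_of j.2 f, LinearMap.mem_ker.1 hf]
  rfl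

theorem mem_range_extMap {J : ι → Prop} {f : ι → A K n} :
    f ∈ LinearMap.range (extMap J : _ →ₗ[A K n] (ι → A K n)) ↔ ∀ j, ¬ J j → f j = 0 := by
  refine ⟨?_, fun h => ⟨fun j => f j, funext fun j => ?_⟩⟩
  · rintro ⟨g, rfl⟩ j hj
    exact extMap_of_not hj g
  · by_cases hj : J j
    · rw [extMap_of hj]
    · rw [extMap_of_not hj, h j hj]

/-- The truncation of the free module in degrees `≥ a`. -/
def trunc (K : Type*) [Field K] {n : ℕ} (d : ι → ℕ) (a : ℕ) : Submodule (A K n) (ι → A K n) :=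
  monoSub K (fun j u => a ≤ wdeg 1 u + d j) fun j u v h => by
    rw [wdeg_add]
    omega

theorem mem_trunc {a : ℕ} {f : ι → A K n} :
    f ∈ trunc K d a ↔ ∀ j u, coeff u (f j) ≠ 0 → a ≤ wdeg 1 u + d j := Iff.rfl

theorem Hg.mem_trunc {a b : ℕ} {f : ι → A K n} (hf : Hg 1 d b f) (h : a ≤ b) : f ∈ trunc K d a :=
  fun j u hu => h.trans_eq (hf j u hu).symm

theorem mem_trunc_iff_cmp {a : ℕ} {f : ι → A K n} :
    f ∈ trunc K d a ↔ ∀ c < a, cmp 1 d c f = 0 := by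
  refine ⟨fun h c hc => vec_ext fun j u => ?_, fun h j u hu => ?_⟩
  · rw [coeff_cut, Pi.zero_apply, coeff_zero]
    have := h j u
    grind
  · by_contra hlt
    have := congrArg (coeff u) (congrFun (h _ (not_le.1 hlt)) j)
    rw [coeff_cut, if_pos rfl] at this
    exact hu this

theorem gr_trunc {w : Fin n → ℕ} {a : ℕ} {δ : ι → ℕ} : Gr w δ (trunc K d a) := gr_monoSub

theorem GM.range_inf_trunc [Fintype κ] {φ : (κ → A K n) →ₗ[A K n] (ι → A K n)} (h : GM 1 e d φ)
    (a : ℕ) :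
    LinearMap.range φ ⊓ trunc K d a = (trunc K e a).map φ := by
  refine le_antisymm ?_ ?_
  · rintro _ ⟨⟨y, rfl⟩, hy⟩
    have hy' := mem_trunc_iff_cmp.1 hy
    refine ⟨y - ∑ c ∈ Finset.range a, cmp 1 e c y, mem_trunc_iff_cmp.2 fun c hc => ?_, ?_⟩
    · rw [map_sub, map_sum, Finset.sum_eq_single c]
      · rw [(hg_cmp 1 e c y).cmp_eq, sub_self]
      · intro b _ hb
        exact (hg_cmp 1 e b y).cmp_ne hb.symm
      · intro hc'
        exact absurd (Finset.mem_range.2 hc) hc'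
    · rw [map_sub, map_sum, Finset.sum_eq_zero, sub_zero]
      intro c hc
      rw [← h.cmp_apply]
      exact hy' c (Finset.mem_range.1 hc)
  · rintro _ ⟨y, hy, rfl⟩
    refine ⟨⟨y, rfl⟩, mem_trunc_iff_cmp.2 fun c hc => ?_⟩
    rw [h.cmp_apply, mem_trunc_iff_cmp.1 hy c hc, map_zero]

end Monomial

section Truncation

variable {K : Type*} [Field K] {n : ℕ} {ι κ : Type} [Fintype ι] [Fintype κ]
  {d : ι → ℕ} {e : κ → ℕ} {r t : ℕ}

open MvPolynomial

theorem Reg.shift {M : Submodule (A K n) (ι → A K n)} (h : Reg t d M r) :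
    Reg t (fun j => d j + 1) M (r + 1) := by
  induction t generalizing ι r with
  | zero => trivial
  | succ t ih =>
    obtain ⟨κ, _, e, φ, hφ, he, hM, hk⟩ := h
    refine ⟨κ, inferInstance, fun l => e l + 1, φ, ?_, fun l => Nat.succ_le_succ (he l), hM, ih hk⟩
    intro a f hf j u hu
    dsimp only [Hg] at hf ⊢
    cases a with
    | zero =>
      have : f = 0 := WLt.eq_zero (w := 1) (d := e) fun j u hu => by
        have := hf j u hu
        omega
      simp [this] at hu
    | succ a =>
      have := hφ a f (fun j u hu => by have := hf j u hu; omega) j u hu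
      omega

theorem reg_monoSub_free {P : ι → (Fin n →₀ ℕ) → Prop} {hP : ∀ j u v, P j u → P j (v + u)}
    {J : ι → Prop} (h : ∀ j u, P j u ↔ J j) (hd : ∀ j, J j → d j ≤ r) :
    Reg t d (monoSub K P hP) r := by
  classical
  have : monoSub K P hP = (⊤ : Submodule (A K n) _).map (extMap J) := by
    ext f
    rw [← LinearMap.range_eq_map, mem_range_extMap, mem_monoSub]
    simp only [h]
    refine forall_congr' fun j => ⟨fun h1 h2 => ?_, fun h1 u hu => ?_⟩
    · ext u
      by_contra hu
      exact h2 (h1 u hu)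
    · by_contra h2
      simp [h1 h2] at hu
  rw [this]
  exact Reg.map_of_injOn gm_extMap (by rw [ker_extMap, inf_bot_eq]) (reg_top fun j => hd j j.2)

/-- Vectors supported in positions satisfying `J`, whose degree counted with the variables in `S`
is at least `a`. -/
def partialTrunc (K : Type*) [Field K] (d : ι → ℕ) (J : ι → Prop) (S : Finset (Fin n)) (a : ℕ) :
    Submodule (A K n) (ι → A K n) :=
  monoSub K (fun j u => J j ∧ a ≤ ∑ s ∈ S, u s + d j) fun j u v h => ⟨h.1, by
    simp only [Finsupp.add_apply, Finset.sum_add_distrib]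
    exact h.2.trans (by omega)⟩

theorem reg_partialTrunc {a : ℕ} {J : ι → Prop} {S : Finset (Fin n)} (ha : a ≤ r)
    (hJ : ∀ j, J j → d j ≤ r) : Reg t d (partialTrunc K d J S a) r := by
  classical
  induction S using Finset.induction_on generalizing a J r t with
  | empty =>
    refine reg_monoSub_free (J := fun j => J j ∧ a ≤ d j) (fun j u => ?_) fun j h => hJ j h.1
    simp
  | insert s S hs ihS =>
    induction a generalizing J r t with
    | zero => exact reg_monoSub_free (J := J) (fun j u => by simp) hJ
    | succ a iha =>
      cases t with
      | zero => trivial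
      | succ t =>
        have hsum : ∀ u : Fin n →₀ ℕ,
            ∑ i ∈ S, (u - Finsupp.single s 1 : Fin n →₀ ℕ) i = ∑ i ∈ S, u i :=
          fun u => Finset.sum_congr rfl fun i hi => by
            rw [Finsupp.tsub_apply, Finsupp.single_eq_of_ne (by grind), Nat.sub_zero]
        have hup : ∀ (T : Finset (Fin n)) (j : ι) (u v : Fin n →₀ ℕ),
            (1 ≤ u s ∧ (J j ∧ d j ≤ a) ∧ a + 1 ≤ ∑ i ∈ T, u i + d j) →
            1 ≤ (v + u) s ∧ (J j ∧ d j ≤ a) ∧ a + 1 ≤ ∑ i ∈ T, (v + u) i + d j := by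
          intro T j u v h
          simp only [Finsupp.add_apply, Finset.sum_add_distrib]
          exact ⟨by omega, h.2.1, by omega⟩
        have hmap : (partialTrunc K d (fun j => J j ∧ d j ≤ a) (insert s S) a).map (mulX s) =
            monoSub K _ (hup (insert s S)) := map_mulX_monoSub s fun j u => by
          beta_reduce
          rw [Finset.sum_insert hs, Finset.sum_insert hs, hsum, Finsupp.tsub_apply,
            Finsupp.single_eq_same]
          grind
        have hmap' : (partialTrunc K d (fun j => J j ∧ d j ≤ a) S (a + 1)).map (mulX s) =
            monoSub K _ (hup S) := map_mulX_monoSub s fun j u => by rw [hsum]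
        have hsup : partialTrunc K d J (insert s S) (a + 1) = partialTrunc K d J S (a + 1) ⊔
            (partialTrunc K d (fun j => J j ∧ d j ≤ a) (insert s S) a).map (mulX s) := by
          rw [hmap]
          refine (monoSub_sup fun j u => ?_).symm
          rw [Finset.sum_insert hs]
          grind
        have hinf : partialTrunc K d J S (a + 1) ⊓
            (partialTrunc K d (fun j => J j ∧ d j ≤ a) (insert s S) a).map (mulX s) =
            (partialTrunc K d (fun j => J j ∧ d j ≤ a) S (a + 1)).map (mulX s) := by
          rw [hmap, hmap']
          refine monoSub_inf fun j u => ?_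
          rw [Finset.sum_insert hs]
          grind
        have hX : ∀ {t r'} {N : Submodule (A K n) (ι → A K n)}, Reg t d N r' →
            Reg t d (N.map (mulX s)) (r' + 1) := fun h =>
          Reg.map_of_injOn (gm_mulX s) (by rw [ker_mulX, inf_bot_eq]) h.shift
        rw [hsup]
        refine Reg.sup gr_monoSub ?_ (ihS ha hJ) ?_ ?_
        · exact (gm_mulX s).gr_map gr_monoSub
        · exact Reg.mono ha (hX (iha le_rfl fun j h => h.2))
        · rw [hinf]
          exact Reg.mono (by omega) (hX (ihS (r := a + 1) le_rfl fun j h => by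
            have := h.2
            omega))

theorem reg_trunc {a : ℕ} (ha : a ≤ r) (hd : ∀ j, d j ≤ r) :
    Reg t d (trunc K d a : Submodule (A K n) _) r := by
  have : (trunc K d a : Submodule (A K n) _) = partialTrunc K d (fun _ => True) Finset.univ a := by
    ext f
    rw [mem_trunc, partialTrunc, mem_monoSub]
    have : ∀ u : Fin n →₀ ℕ, wdeg 1 u = ∑ s, u s := fun u => by
      simp [wdeg, Finsupp.sum_fintype]
    simp [this]
  rw [this]
  exact reg_partialTrunc ha fun j _ => hd j

theorem Reg.inf_trunc {a : ℕ} {N : Submodule (A K n) (ι → A K n)} (h : Reg t d N r) (ha : a ≤ r) :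
    Reg t d (N ⊓ trunc K d a) r := by
  induction t generalizing ι r with
  | zero => trivial
  | succ t ih =>
    obtain ⟨κ, _, e, φ, hφ, he, rfl, hk⟩ := h
    rw [hφ.range_inf_trunc]
    refine Reg.map hφ (reg_trunc ha he) ?_
    rw [inf_comm]
    exact ih hk (by omega)

end Truncation

end CregPaper

namespace CregPaper

section MinimalGenerators

variable {K : Type*} [Field K] {n : ℕ} {ι : Type} [Fintype ι] {d : ι → ℕ}

open MvPolynomial

/-- A generating set of homogeneous elements contains a finite minimal system of generators. -/
theorem exists_minimal_generators {S : Set (ι → A K n)} (hS : ∀ s ∈ S, ∃ a, Hg 1 d a s) :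
    ∃ (m : ℕ) (g : Fin m → ι → A K n) (e : Fin m → ℕ), (∀ l, g l ∈ S) ∧
      (∀ l, Hg 1 d (e l) (g l)) ∧
      Submodule.span (A K n) (Set.range g) = Submodule.span (A K n) S ∧
      MMin (LinearMap.ker (Fintype.linearCombination (A K n) g)) := by
  classical
  have hex : ∃ (m : ℕ) (g : Fin m → ι → A K n), (∀ l, g l ∈ S) ∧
      Submodule.span (A K n) (Set.range g) = Submodule.span (A K n) S := by
    obtain ⟨T, hTS, hT⟩ := (Submodule.fg_span_iff_fg_span_finset_subset S).1
      (IsNoetherian.noetherian (Submodule.span (A K n) S))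
    refine ⟨T.card, fun l => T.equivFin.symm l, fun l => hTS (T.equivFin.symm l).2, ?_⟩
    rw [hT]
    congr 1
    ext x
    refine ⟨?_, fun hx => ⟨T.equivFin ⟨x, hx⟩, by simp⟩⟩
    rintro ⟨l, rfl⟩
    exact (T.equivFin.symm l).2
  obtain ⟨g, hg, hspan⟩ := Nat.find_spec hex
  have hmin := fun k => Nat.find_min hex (m := k)
  generalize Nat.find hex = m at g hg hspan hmin
  choose e he using fun l => hS _ (hg l)
  refine ⟨m, g, e, hg, he, hspan, fun x hx l => ?_⟩
  by_contra hc
  rw [mem_mIdeal] at hc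
  have hy := (gm_linearCombination he).gr_ker x hx (e l)
  set y := cmp 1 e (e l) x with hy_def
  have hyl : y l = C (coeff 0 (x l)) := by
    ext u
    rw [hy_def, coeff_cut, coeff_C]
    by_cases hu : u = 0
    · simp [hu]
    · have h1 : ¬ wdeg 1 u + e l = e l := fun h => hu (eq_zero_of_wdeg_one (by omega))
      rw [if_neg h1, if_neg (Ne.symm hu)]
  obtain _ | m := m
  · exact l.elim0
  refine hmin m (Nat.lt_succ_self m) ⟨g ∘ l.succAbove, fun i => hg _, ?_⟩
  rw [← hspan]
  refine le_antisymm (Submodule.span_mono (Set.range_comp_subset_range _ _)) ?_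
  rw [Submodule.span_le]
  have hmem : ∀ j, j ≠ l →
      g j ∈ Submodule.span (A K n) (Set.range (g ∘ l.succAbove)) := fun j hj => by
    obtain ⟨i, rfl⟩ := Fin.exists_succAbove_eq hj
    exact Submodule.subset_span ⟨i, rfl⟩
  rintro _ ⟨j, rfl⟩
  by_cases hj : j = l
  · subst hj
    have h0 : y j • g j + ∑ i, y (j.succAbove i) • g (j.succAbove i) = 0 := by
      have := LinearMap.mem_ker.1 hy
      rwa [Fintype.linearCombination_apply, Fin.sum_univ_succAbove _ j] at this
    have h1 : g j = (C (coeff 0 (x j))⁻¹ : A K n) •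
        (- ∑ i, y (j.succAbove i) • g (j.succAbove i)) := by
      rw [← eq_neg_of_add_eq_zero_left h0, hyl, smul_smul, ← C_mul, inv_mul_cancel₀ hc, C_1,
        one_smul]
    rw [h1]
    exact Submodule.smul_mem _ _ (neg_mem (sum_mem fun i _ =>
      Submodule.smul_mem _ _ (hmem _ (Fin.succAbove_ne j i))))
  · exact hmem j hj

end MinimalGenerators

section Components

variable {K : Type*} [Field K] {n : ℕ} {ι κ : Type} {d : ι → ℕ} {e : κ → ℕ}
  {M : Submodule (A K n) (ι → A K n)} {a b c : ℕ}

open MvPolynomial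

/-- The submodule generated by the homogeneous elements of degree at most `b`. -/
noncomputable def lowSub (d : ι → ℕ) (M : Submodule (A K n) (ι → A K n)) (b : ℕ) :
    Submodule (A K n) (ι → A K n) :=
  Submodule.span (A K n) {f | f ∈ M ∧ ∃ c ≤ b, Hg 1 d c f}

/-- The submodule generated by the homogeneous elements of degree `a`. -/
noncomputable def eqSub (d : ι → ℕ) (M : Submodule (A K n) (ι → A K n)) (a : ℕ) :
    Submodule (A K n) (ι → A K n) :=
  Submodule.span (A K n) {f | f ∈ M ∧ Hg 1 d a f}

theorem gr_lowSub : Gr 1 d (lowSub d M b) :=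
  gr_span fun _ hs => let ⟨c, _, h⟩ := hs.2; ⟨c, h⟩

theorem gr_eqSub : Gr 1 d (eqSub d M a) := gr_span fun _ hs => ⟨a, hs.2⟩

theorem lowSub_le : lowSub d M b ≤ M := Submodule.span_le.2 fun _ h => h.1

theorem eqSub_le_trunc (h : b ≤ a) : eqSub d M a ≤ trunc K d b :=
  Submodule.span_le.2 fun _ hf => hf.2.mem_trunc h

theorem eqSub_le_lowSub (h : a ≤ b) : eqSub d M a ≤ lowSub d M b :=
  Submodule.span_mono fun _ hf => ⟨hf.1, a, h, hf.2⟩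

theorem lowSub_mono (h : a ≤ b) : lowSub d M a ≤ lowSub d M b :=
  Submodule.span_mono fun _ hf => let ⟨c, hc, hc'⟩ := hf.2; ⟨hf.1, c, hc.trans h, hc'⟩

theorem lowSub_zero : lowSub d M 0 = eqSub d M 0 := by
  refine le_antisymm (Submodule.span_mono fun f hf => ?_) (eqSub_le_lowSub le_rfl)
  obtain ⟨hf, c, hc, hc'⟩ := hf
  obtain rfl : c = 0 := by omega
  exact ⟨hf, hc'⟩

theorem lowSub_succ : lowSub d M (b + 1) = lowSub d M b ⊔ eqSub d M (b + 1) := by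
  refine le_antisymm (Submodule.span_le.2 fun f hf => ?_)
    (sup_le (lowSub_mono (Nat.le_succ b)) (eqSub_le_lowSub le_rfl))
  obtain ⟨hf, c, hc, hc'⟩ := hf
  rcases Nat.le_succ_iff.1 hc with h | rfl
  · exact Submodule.mem_sup_left (Submodule.subset_span ⟨hf, c, h, hc'⟩)
  · exact Submodule.mem_sup_right (Submodule.subset_span ⟨hf, hc'⟩)

theorem exists_le_wdeg_one_eq (u : Fin n →₀ ℕ) (k : ℕ) (h : k ≤ wdeg 1 u) :
    ∃ v ≤ u, wdeg 1 v = k := by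
  induction k with
  | zero => exact ⟨0, zero_le, wdeg_zero 1⟩
  | succ k ih =>
    obtain ⟨v, hv, rfl⟩ := ih (by omega)
    have hne : v ≠ u := by
      rintro rfl
      omega
    obtain ⟨i, hi⟩ : ∃ i, v i ≠ u i := by
      by_contra! hc
      exact hne (Finsupp.ext hc)
    refine ⟨v + Finsupp.single i 1, fun j => ?_, by rw [wdeg_add]; simp [wdeg]⟩
    have h1 := hv j
    have h2 := hv i
    rw [Finsupp.add_apply, Finsupp.single_apply]
    split_ifs with hij
    · subst hij
      omega
    · omega

theorem cmp_mem_eqSub {x : ι → A K n} (hx : x ∈ lowSub d M b) (hba : b ≤ a) (hac : a ≤ c) :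
    cmp 1 d c x ∈ eqSub d M a := by
  induction hx using Submodule.closure_induction with
  | zero => simp
  | add x y _ _ hx hy =>
    rw [map_add]
    exact add_mem hx hy
  | smul_mem r x hx =>
    obtain ⟨hxM, c', hc', hxc⟩ := hx
    induction r using MvPolynomial.induction_on' with
    | add p q hp hq =>
      rw [add_smul, map_add]
      exact add_mem hp hq
    | monomial u k =>
      have h1 := hxc.monomial_smul u k
      by_cases hc : c = wdeg 1 u + c'
      · rw [hc, h1.cmp_eq]
        obtain ⟨v, hv, hvk⟩ := exists_le_wdeg_one_eq u (a - c') (by omega)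
        have h2 := hxc.monomial_smul v (1 : K)
        have h3 : (monomial u k : A K n) • x =
            (monomial (u - v) k : A K n) • ((monomial v 1 : A K n) • x) := by
          rw [smul_smul, monomial_mul, tsub_add_cancel_of_le hv, mul_one]
        rw [h3]
        refine Submodule.smul_mem _ _ (Submodule.subset_span ⟨Submodule.smul_mem _ _ hxM, ?_⟩)
        convert h2 using 1
        omega
      · rw [h1.cmp_ne hc]
        exact zero_mem _

theorem map_lowSub_le {N : Submodule (A K n) (κ → A K n)}
    {f : (ι → A K n) →ₗ[A K n] (κ → A K n)} (hf : GM 1 d e f) (h : ∀ x ∈ M, f x ∈ N) :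
    ∀ x ∈ lowSub d M b, f x ∈ lowSub e N b := by
  refine fun x hx => (Submodule.span_le (p := (lowSub e N b).comap f)).2 ?_ hx
  rintro y ⟨hy, c, hc, hyc⟩
  exact Submodule.subset_span ⟨h y hy, c, hc, hf _ _ hyc⟩

theorem range_comp_extMap [Fintype κ] {φ : (κ → A K n) →ₗ[A K n] (ι → A K n)} (hφ : GM 1 e d φ)
    (b : ℕ) :
    LinearMap.range (φ ∘ₗ extMap fun l => e l ≤ b) = lowSub d (LinearMap.range φ) b := by
  classical
  refine le_antisymm ?_ (Submodule.span_le.2 ?_)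
  · rintro _ ⟨x, rfl⟩
    rw [pi_eq_sum_univ' x, map_sum]
    refine sum_mem fun l _ => ?_
    rw [map_smul]
    refine Submodule.smul_mem _ _ (Submodule.subset_span ⟨⟨_, rfl⟩, e l, l.2, ?_⟩)
    exact hφ _ _ (gm_extMap _ _ (hg_single (d := fun l : {l // e l ≤ b} => e l) l))
  · rintro y ⟨hy, c, hc, hyc⟩
    obtain ⟨x, -, hx, rfl⟩ := Gr.exists_hg_of_mem_map gr_top hφ (LinearMap.range_eq_map φ ▸ hy) hyc
    obtain ⟨z, rfl⟩ : x ∈ LinearMap.range (extMap fun l => e l ≤ b) := by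
      refine mem_range_extMap.2 fun l hl => ?_
      ext u
      by_contra hu
      have := hx l u hu
      omega
    exact ⟨z, rfl⟩

theorem MMin.ker_comp_extMap {φ : (κ → A K n) →ₗ[A K n] (ι → A K n)}
    (h : MMin (LinearMap.ker φ)) (J : κ → Prop) : MMin (LinearMap.ker (φ ∘ₗ extMap J)) :=
  fun x hx l => by
    rw [← extMap_of l.2 x]
    exact h _ hx l

/-- A homogeneous relation of degree at most `b + 1` with coordinates in the maximal ideal only
involves the basis elements of degree at most `b`. -/
theorem MMin.mem_range_extMap {N : Submodule (A K n) (κ → A K n)} (h : MMin N) {x : κ → A K n}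
    (hx : x ∈ N) (hxc : Hg 1 e c x) (hc : c ≤ b + 1) :
    x ∈ LinearMap.range (extMap fun l => e l ≤ b) := by
  refine CregPaper.mem_range_extMap.2 fun l hl => ?_
  ext u
  by_contra hu
  have h1 := hxc l u hu
  obtain rfl : u = 0 := eq_zero_of_wdeg_one (by omega)
  exact hu (mem_mIdeal.1 (h x hx l))

variable [Fintype ι]

theorem lowSub_inf_trunc_le (hba : b ≤ a) : lowSub d M b ⊓ trunc K d a ≤ eqSub d M a := by
  refine (gr_lowSub.inf gr_trunc).le_of_hg fun c x hx hxc => ?_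
  by_cases hac : a ≤ c
  · rw [← hxc.cmp_eq]
    exact cmp_mem_eqSub hx.1 hba hac
  · rw [← hxc.cmp_eq, mem_trunc_iff_cmp.1 hx.2 c (by omega)]
    exact zero_mem _

theorem lowSub_inf_eqSub_succ :
    lowSub d M b ⊓ eqSub d M (b + 1) = lowSub d M b ⊓ trunc K d (b + 1) :=
  le_antisymm (inf_le_inf_left _ (eqSub_le_trunc le_rfl))
    (le_inf inf_le_left (lowSub_inf_trunc_le (Nat.le_succ b)))

theorem lowSub_inf_trunc : lowSub d M a ⊓ trunc K d a = eqSub d M a :=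
  le_antisymm (lowSub_inf_trunc_le le_rfl) (le_inf (eqSub_le_lowSub le_rfl) (eqSub_le_trunc le_rfl))

/-- Componentwise linearity, in terms of the submodules generated in bounded degrees. -/
def CL (d : ι → ℕ) (M : Submodule (A K n) (ι → A K n)) : Prop :=
  ∀ b t, Reg t d (lowSub d M b) b

theorem CL.reg_eqSub (h : CL d M) (a t : ℕ) : Reg t d (eqSub d M a) a := by
  rw [← lowSub_inf_trunc]
  exact (h a t).inf_trunc le_rfl

theorem cl_of_reg_eqSub (h : ∀ a t, Reg t d (eqSub d M a) a) : CL d M := by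
  intro b
  induction b with
  | zero =>
    rw [lowSub_zero]
    exact h 0
  | succ b ih =>
    intro t
    cases t with
    | zero => trivial
    | succ t =>
      rw [lowSub_succ]
      refine Reg.sup gr_lowSub gr_eqSub ((ih _).mono (Nat.le_succ b)) (h _ _) ?_
      rw [lowSub_inf_eqSub_succ]
      exact Reg.inf_trunc ((ih _).mono (by omega)) (by omega)

variable [Fintype κ]

theorem CL.retract {N : Submodule (A K n) (κ → A K n)} {f : (ι → A K n) →ₗ[A K n] (κ → A K n)}
    {p : (κ → A K n) →ₗ[A K n] (ι → A K n)} (hf : GM 1 d e f) (hp : GM 1 e d p)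
    (hfM : ∀ x ∈ M, f x ∈ N) (hpN : ∀ y ∈ N, p y ∈ M) (hpf : ∀ x ∈ M, p (f x) = x)
    (h : CL e N) : CL d M := fun b t =>
  Reg.retract hf hp (map_lowSub_le hf hfM) (map_lowSub_le hp hpN)
    (fun x hx => hpf x (lowSub_le hx)) (h b t)

theorem Reg.le_lowSub {t : ℕ} (h : Reg (t + 1) d M a) : M ≤ lowSub d M a := by
  obtain ⟨κ, _, e, φ, hφ, he, rfl, -⟩ := h
  rw [← range_comp_extMap hφ]
  rintro _ ⟨x, rfl⟩
  obtain ⟨z, rfl⟩ : x ∈ LinearMap.range (extMap fun l => e l ≤ a) :=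
    mem_range_extMap.2 fun l hl => absurd (he l) hl
  exact ⟨z, rfl⟩

/-- The first syzygy module of a componentwise linear module is componentwise linear. -/
theorem CL.ker (h : CL d M) {ψ : (κ → A K n) →ₗ[A K n] (ι → A K n)} (hψ : GM 1 e d ψ)
    (hr : LinearMap.range ψ = M) (hm : MMin (LinearMap.ker ψ)) : CL e (LinearMap.ker ψ) := by
  subst hr
  rintro (_ | b) t
  · have : lowSub e (LinearMap.ker ψ) 0 = ⊥ := by
      refine (Submodule.span_eq_bot).2 ?_
      rintro x ⟨hx, c, hc, hxc⟩
      refine vec_ext fun l u => ?_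
      by_contra hu
      have h1 := hxc l u hu
      obtain rfl : u = 0 := eq_zero_of_wdeg_one (by omega)
      exact hu (mem_mIdeal.1 (hm x hx l))
    rw [this]
    exact reg_bot
  · have hψ' := hψ.comp (gm_extMap (J := fun l => e l ≤ b))
    have key : ∀ t, Reg t _ _ (b + 1) := fun t =>
      ((h b (t + 1)).of_minimal hψ' (range_comp_extMap hψ b) (hm.ker_comp_extMap _)).2
    have : lowSub e (LinearMap.ker ψ) (b + 1) =
        (LinearMap.ker (ψ ∘ₗ extMap fun l => e l ≤ b)).map (extMap fun l => e l ≤ b) := by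
      refine le_antisymm (Submodule.span_le.2 ?_) ?_
      · rintro x ⟨hx, c, hc, hxc⟩
        obtain ⟨z, rfl⟩ := hm.mem_range_extMap hx hxc hc
        exact ⟨z, hx, rfl⟩
      · rintro _ ⟨z, hz, rfl⟩
        exact map_lowSub_le gm_extMap (fun z hz => hz) _ ((key 1).le_lowSub hz)
    rw [this]
    exact Reg.map_of_injOn gm_extMap (by rw [ker_extMap, inf_bot_eq]) (key t)

end Components

end CregPaper

namespace CregPaper

section InitialModules

variable {K : Type*} [Field K] {n : ℕ} {ι κ : Type} {ω : Fin n → ℕ} {ε d : ι → ℕ}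
  {η e : κ → ℕ} {N : Submodule (A K n) (ι → A K n)} {w b a r : ℕ}

open MvPolynomial

theorem Hg.cut_apply {w : Fin n → ℕ} {p : ι → (Fin n →₀ ℕ) → Prop} {f : ι → A K n}
    (hf : Hg w d a f) : Hg w d a (cut p f) := by
  intro j u hu
  rw [coeff_cut] at hu
  exact hf j u (by grind)

theorem WLt.smul {c : ℕ} {w : Fin n → ℕ} {f : ι → A K n} {p : A K n}
    (hp : ∀ u, coeff u p ≠ 0 → wdeg w u + b ≤ c) (hf : WLt w d b f) : WLt w d c (p • f) := by
  intro j u hu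
  rw [Pi.smul_apply, smul_eq_mul, coeff_mul] at hu
  obtain ⟨⟨x, y⟩, hxy, hne⟩ := Finset.exists_ne_zero_of_sum_ne_zero hu
  have h1 := hp x (left_ne_zero_of_mul hne)
  have h2 := hf j y (right_ne_zero_of_mul hne)
  rw [← Finset.HasAntidiagonal.mem_antidiagonal.1 hxy, wdeg_add]
  dsimp only
  omega

/-- The module spanned by the leading components of the elements of `N`. -/
noncomputable def ini (ω : Fin n → ℕ) (ε : ι → ℕ) (N : Submodule (A K n) (ι → A K n)) :
    Submodule (A K n) (ι → A K n) :=
  Submodule.span (A K n) {s | ∃ w, ∃ f ∈ N, WLt ω ε (w + 1) f ∧ s = cmp ω ε w f}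

theorem cmp_mem_ini {f : ι → A K n} (hf : f ∈ N) (h : WLt ω ε (w + 1) f) :
    cmp ω ε w f ∈ ini ω ε N := Submodule.subset_span ⟨w, f, hf, h, rfl⟩

/-- The leading components of the homogeneous elements of `N`. -/
def leadSet (ω : Fin n → ℕ) (ε d : ι → ℕ) (N : Submodule (A K n) (ι → A K n)) :
    Set (ι → A K n) :=
  {s | ∃ w a, ∃ f ∈ N, Hg 1 d a f ∧ WLt ω ε (w + 1) f ∧ s = cmp ω ε w f}

theorem hg_of_mem_leadSet {s : ι → A K n} (hs : s ∈ leadSet ω ε d N) : ∃ a, Hg 1 d a s := by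
  obtain ⟨w, a, f, -, hf, -, rfl⟩ := hs
  exact ⟨a, hf.cut_apply⟩

theorem exists_lead {x : ι → A K n} (hx : x ∈ ini ω ε N) (w : ℕ) :
    ∃ f ∈ N, WLt ω ε (w + 1) f ∧ cmp ω ε w f = cmp ω ε w x := by
  induction hx using Submodule.closure_induction with
  | zero => exact ⟨0, zero_mem _, wlt_of_zero, rfl⟩
  | add x y _ _ hx hy =>
    obtain ⟨f, hf, hf', hfx⟩ := hx
    obtain ⟨g, hg, hg', hgx⟩ := hy
    exact ⟨f + g, add_mem hf hg, hf'.add hg', by rw [map_add, map_add, hfx, hgx]⟩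
  | smul_mem r x hx =>
    obtain ⟨w', f, hf, hfw, rfl⟩ := hx
    induction r using MvPolynomial.induction_on' with
    | add p q hp hq =>
      obtain ⟨f, hf, hf', hfx⟩ := hp
      obtain ⟨g, hg, hg', hgx⟩ := hq
      exact ⟨f + g, add_mem hf hg, hf'.add hg', by rw [add_smul, map_add, map_add, hfx, hgx]⟩
    | monomial u k =>
      have h1 := (hg_cmp ω ε w' f).monomial_smul u k
      by_cases hw : w = wdeg ω u + w'
      · refine ⟨(monomial u k : A K n) • f, Submodule.smul_mem _ _ hf,
          WLt.smul (fun v hv => ?_) hfw, ?_⟩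
        · rw [coeff_monomial] at hv
          grind
        · rw [hw, h1.cmp_eq, cmp_monomial_smul, if_pos (Nat.le_add_right _ _),
            Nat.add_sub_cancel_left]
      · exact ⟨0, zero_mem _, wlt_of_zero, by rw [h1.cmp_ne hw, map_zero]⟩

theorem exists_homogeneous_lead (hN : Gr 1 d N) {x : ι → A K n} (hx : x ∈ ini ω ε N)
    (hxw : Hg ω ε w x) (hxa : Hg 1 d a x) :
    ∃ f ∈ N, Hg 1 d a f ∧ WLt ω ε (w + 1) f ∧ cmp ω ε w f = x := by
  obtain ⟨f, hf, hfw, hfx⟩ := exists_lead hx w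
  refine ⟨cmp 1 d a f, hN f hf a, hg_cmp _ _ _ _, hfw.cut_apply, ?_⟩
  rw [cmp_comm, hfx, hxw.cmp_eq, hxa.cmp_eq]

theorem ini_eq_span [Fintype ι] (hN : Gr 1 d N) :
    ini ω ε N = Submodule.span (A K n) (leadSet ω ε d N) := by
  refine le_antisymm (Submodule.span_le.2 ?_) (Submodule.span_mono ?_)
  · rintro _ ⟨w, f, hf, hfw, rfl⟩
    refine Gr.mem_of_cmp (w := 1) (d := d) fun a => ?_
    rw [cmp_comm]
    exact Submodule.subset_span ⟨w, a, _, hN f hf a, hg_cmp _ _ _ _, hfw.cut_apply, rfl⟩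
  · rintro _ ⟨w, a, f, hf, -, hfw, rfl⟩
    exact ⟨w, f, hf, hfw, rfl⟩

variable [Fintype κ]

/-- `φ₀` is the leading part of `φ` with respect to the weights. -/
structure Degen (ω : Fin n → ℕ) (η : κ → ℕ) (ε : ι → ℕ)
    (φ φ₀ : (κ → A K n) →ₗ[A K n] (ι → A K n)) : Prop where
  gm : GM ω η ε φ₀
  lt : ∀ w f, WLt ω η (w + 1) f → WLt ω ε w (φ f - φ₀ f)

variable {φ φ₀ : (κ → A K n) →ₗ[A K n] (ι → A K n)}

theorem Degen.wlt (h : Degen ω η ε φ φ₀) {f : κ → A K n} (hf : WLt ω η (w + 1) f) :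
    WLt ω ε (w + 1) (φ f) := by
  have := ((h.lt w f hf).mono (Nat.le_succ w)).add (h.gm.wlt hf)
  rwa [sub_add_cancel] at this

theorem Degen.cmp (h : Degen ω η ε φ φ₀) {f : κ → A K n} (hf : WLt ω η (w + 1) f) :
    cmp ω ε w (φ f) = φ₀ (cmp ω η w f) := by
  have := (h.lt w f hf).cmp_eq_zero le_rfl
  rw [map_sub, sub_eq_zero] at this
  rw [this, h.gm.cmp_apply]

theorem Degen.ini_ker_le (h : Degen ω η ε φ φ₀) :
    ini ω η (LinearMap.ker φ) ≤ LinearMap.ker φ₀ := by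
  refine Submodule.span_le.2 ?_
  rintro _ ⟨w, f, hf, hfw, rfl⟩
  rw [SetLike.mem_coe, LinearMap.mem_ker, ← h.cmp hfw, LinearMap.mem_ker.1 hf, map_zero]

theorem Degen.exists_preimage (h : Degen ω η ε φ φ₀) (hφ : LinearMap.range φ ≤ N)
    (hφ₀ : ini ω ε N ≤ LinearMap.range φ₀) {x : ι → A K n} (hx : x ∈ N) (hxw : WLt ω ε w x) :
    ∃ c, WLt ω η w c ∧ φ c = x := by
  induction w generalizing x with
  | zero => exact ⟨0, wlt_of_zero, by rw [hxw.eq_zero, map_zero]⟩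
  | succ w ih =>
    have h1 := hφ₀ (cmp_mem_ini hx hxw)
    rw [LinearMap.range_eq_map] at h1
    obtain ⟨y, -, hy, hyx⟩ := Gr.exists_hg_of_mem_map gr_top h.gm h1 (hg_cmp _ _ _ _)
    have hy1 := hy.wlt (Nat.lt_succ_self w)
    obtain ⟨c, hc, hcx⟩ := ih (x := x - φ y) (sub_mem hx (hφ ⟨y, rfl⟩))
      ((hxw.sub (h.wlt hy1)).of_cmp_eq_zero (by
        rw [map_sub, h.cmp hy1, hy.cmp_eq, hyx, sub_self]))
    exact ⟨y + c, hy1.add (hc.mono (Nat.le_succ w)), by rw [map_add, hcx, add_sub_cancel]⟩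

theorem Degen.range_eq [Fintype ι] (h : Degen ω η ε φ φ₀) (hφ : LinearMap.range φ ≤ N)
    (hφ₀ : ini ω ε N ≤ LinearMap.range φ₀) : LinearMap.range φ = N := by
  refine le_antisymm hφ fun x hx => ?_
  obtain ⟨b, hb⟩ := exists_wlt ω ε x
  obtain ⟨c, -, hc⟩ := h.exists_preimage hφ hφ₀ hx hb
  exact ⟨c, hc⟩

theorem Degen.ker_eq_ini (h : Degen ω η ε φ φ₀) (hφ : LinearMap.range φ ≤ N)
    (hφ₀ : ini ω ε N ≤ LinearMap.range φ₀) :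
    LinearMap.ker φ₀ = ini ω η (LinearMap.ker φ) := by
  refine le_antisymm (h.gm.gr_ker.le_of_hg fun w s hs hsw => ?_) h.ini_ker_le
  have h1 := hsw.wlt (Nat.lt_succ_self w)
  have h2 := h.lt w s h1
  rw [LinearMap.mem_ker.1 hs, sub_zero] at h2
  obtain ⟨c, hc, hcx⟩ := h.exists_preimage hφ hφ₀ (hφ ⟨s, rfl⟩) h2
  have h3 := cmp_mem_ini (N := LinearMap.ker φ) (f := s - c)
    (by rw [LinearMap.mem_ker, map_sub, hcx, sub_self]) (h1.sub (hc.mono (Nat.le_succ w)))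
  rwa [map_sub, hsw.cmp_eq, hc.cmp_eq_zero le_rfl, sub_zero] at h3

/-- A presentation of `N` together with its leading part, a minimal presentation of the initial
module of `N`. -/
structure DegenPres (ω : Fin n → ℕ) (ε d : ι → ℕ) (N : Submodule (A K n) (ι → A K n))
    (η e : κ → ℕ) (φ φ₀ : (κ → A K n) →ₗ[A K n] (ι → A K n)) : Prop where
  degen : Degen ω η ε φ φ₀
  gm : GM 1 e d φ
  gm₀ : GM 1 e d φ₀
  range : LinearMap.range φ = N
  range₀ : LinearMap.range φ₀ = ini ω ε N
  ker₀ : LinearMap.ker φ₀ = ini ω η (LinearMap.ker φ)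
  min₀ : MMin (LinearMap.ker φ₀)

variable [Fintype ι]

theorem exists_degenPres (ω : Fin n → ℕ) (ε : ι → ℕ) (hN : Gr 1 d N) :
    ∃ (m : ℕ) (η e : Fin m → ℕ) (φ φ₀ : (Fin m → A K n) →ₗ[A K n] (ι → A K n)),
      DegenPres ω ε d N η e φ φ₀ := by
  obtain ⟨m, g, -, hg, -, hspan, hm⟩ :=
    exists_minimal_generators (S := leadSet ω ε d N) fun s => hg_of_mem_leadSet
  choose η e f hf hfe hfη hgf using hg
  have h0 : Degen ω η ε (Fintype.linearCombination (A K n) f)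
      (Fintype.linearCombination (A K n) g) := by
    refine ⟨gm_linearCombination fun l => hgf l ▸ hg_cmp _ _ _ _, fun w c hc => ?_⟩
    rw [Fintype.linearCombination_apply, Fintype.linearCombination_apply,
      ← Finset.sum_sub_distrib]
    refine WLt.sum fun l _ => ?_
    rw [← smul_sub]
    refine WLt.smul (b := η l) (fun u hu => Nat.le_of_lt_succ (hc l u hu)) ?_
    refine WLt.of_cmp_eq_zero ((hfη l).sub ?_) ?_
    · rw [hgf l]
      exact (hg_cmp _ _ _ _).wlt (Nat.lt_succ_self _)
    · rw [map_sub, hgf l, (hg_cmp _ _ _ _).cmp_eq, sub_self]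
  have h1 : LinearMap.range (Fintype.linearCombination (A K n) f) ≤ N := by
    rw [Fintype.range_linearCombination, Submodule.span_le]
    rintro _ ⟨l, rfl⟩
    exact hf l
  have h2 : LinearMap.range (Fintype.linearCombination (A K n) g) = ini ω ε N := by
    rw [Fintype.range_linearCombination, hspan, ← ini_eq_span hN]
  refine ⟨m, η, e, _, _, h0, gm_linearCombination hfe, ?_, h0.range_eq h1 h2.ge, h2,
    h0.ker_eq_ini h1 h2.ge, hm⟩
  refine gm_linearCombination fun l => ?_
  rw [hgf l]
  exact (hfe l).cut_apply

/-- The regularity of a module is at most that of its initial module. -/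
theorem reg_of_reg_ini (hN : Gr 1 d N) (h : ∀ t, Reg t d (ini ω ε N) r) (t : ℕ) :
    Reg t d N r := by
  induction t generalizing ι r with
  | zero => trivial
  | succ t ih =>
    obtain ⟨m, η, e, φ, φ₀, hφ⟩ := exists_degenPres ω ε hN
    have h1 := fun t => (h (t + 1)).of_minimal hφ.gm₀ hφ.range₀ hφ.min₀
    refine ⟨Fin m, inferInstance, e, φ, hφ.gm, (h1 0).1, hφ.range, ?_⟩
    exact ih hφ.gm.gr_ker fun t => hφ.ker₀ ▸ (h1 t).2

/-- If the presentation of `N` obtained from a minimal presentation of a componentwise linear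
initial module is itself minimal, then `N` is componentwise linear. -/
theorem DegenPres.cl {φ φ₀ : (κ → A K n) →ₗ[A K n] (ι → A K n)} (h : DegenPres ω ε d N η e φ φ₀)
    (hm : MMin (LinearMap.ker φ)) (hN : CL d (ini ω ε N)) : CL d N := by
  rintro b (_ | t)
  · trivial
  have hext : ∀ {w : Fin n → ℕ} {δ : κ → ℕ}, GM w (fun l : {l // e l ≤ b} => δ l) δ
      (extMap fun l => e l ≤ b : _ →ₗ[A K n] _) := gm_extMap
  have hker : ∀ t, Reg t (fun l : {l // e l ≤ b} => e l)
      (LinearMap.ker (φ₀ ∘ₗ extMap fun l => e l ≤ b)) (b + 1) := fun t =>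
    (Reg.of_minimal (h.range₀ ▸ hN b (t + 1)) (h.gm₀.comp hext) (range_comp_extMap h.gm₀ b)
      (h.min₀.ker_comp_extMap _)).2
  have heq : LinearMap.ker (φ₀ ∘ₗ extMap fun l => e l ≤ b) =
      ini ω (fun l : {l // e l ≤ b} => η l) (LinearMap.ker (φ ∘ₗ extMap fun l => e l ≤ b)) := by
    refine le_antisymm ?_ (Degen.ini_ker_le ⟨h.degen.gm.comp hext, fun w f hf => ?_⟩)
    · refine ((hker 1).le_lowSub).trans (Submodule.span_le.2 ?_)
      rintro s ⟨hs, c, hc, hsc⟩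
      refine Gr.mem_of_cmp (w := ω) (d := fun l : {l // e l ≤ b} => η l) fun w => ?_
      have hs' := (h.degen.gm.comp hext).gr_ker s hs w
      have hsc' : Hg 1 (fun l : {l // e l ≤ b} => e l) c
        (cmp ω (fun l : {l // e l ≤ b} => η l) w s) := hsc.cut_apply
      have hsw := hg_cmp ω (fun l : {l // e l ≤ b} => η l) w s
      generalize cmp ω (fun l : {l // e l ≤ b} => η l) w s = s at hs' hsc' hsw
      have h1 : extMap (fun l => e l ≤ b) s ∈ ini ω η (LinearMap.ker φ) := h.ker₀ ▸ hs'
      obtain ⟨f, hf, hfc, hfw, hfs⟩ := exists_homogeneous_lead h.gm.gr_ker h1 (hext _ _ hsw)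
        (hext _ _ hsc')
      obtain ⟨z, rfl⟩ := hm.mem_range_extMap hf hfc hc
      rw [hext.cmp_apply] at hfs
      have h2 := LinearMap.ker_eq_bot.1 ker_extMap hfs
      rw [← h2]
      refine cmp_mem_ini hf fun l u hu => hfw l u ?_
      rwa [extMap_of (J := fun l => e l ≤ b) l.2]
    · exact h.degen.lt w _ (hext.wlt hf)
  refine ⟨{l // e l ≤ b}, inferInstance, fun l => e l, φ ∘ₗ extMap fun l => e l ≤ b,
    h.gm.comp hext, fun l => l.2, ?_, ?_⟩
  · rw [range_comp_extMap h.gm, h.range]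
  · exact reg_of_reg_ini (h.gm.comp hext).gr_ker (heq ▸ hker) t

end InitialModules

end CregPaper

namespace CregPaper

section Dictionary

variable {K : Type*} [Field K] {n k : ℕ} {d : Fin k → ℕ} {M : Submodule (A K n) (Fin k → A K n)}

open MvPolynomial

theorem isHomog_iff {a : ℕ} {f : Fin k → A K n} : IsHomog d a f ↔ Hg 1 d a f := by
  simp only [IsHomog, Hg, mem_support_iff, tdeg_eq_wdeg_one]

theorem homogComp_eq {a : ℕ} {f : Fin k → A K n} : homogComp d f a = cmp 1 d a f := by
  classical
  refine vec_ext fun j u => ?_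
  rw [coeff_cut, ← tdeg_eq_wdeg_one]
  unfold homogComp
  convert coeff_sum_filter_monomial (fun u => tdeg u + d j = a) (f j) u

theorem isGradedSub_iff : IsGradedSub d M ↔ Gr 1 d M := by
  simp only [IsGradedSub, Gr, homogComp_eq]

theorem compSub_eq {a : ℕ} : compSub d M a = eqSub d M a := by
  simp only [compSub, eqSub, isHomog_iff]

theorem inForm_eq (ω : Fin n → ℕ) (ε : Fin k → ℕ) (f : Fin k → A K n) :
    inForm ω ε f = cmp ω ε (maxWt ω ε f) f := by
  classical
  refine vec_ext fun j u => ?_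
  rw [coeff_cut]
  unfold inForm
  convert coeff_sum_filter_monomial (fun u => wdeg ω u + ε j = maxWt ω ε f) (f j) u

theorem le_maxWt {ω : Fin n → ℕ} {ε : Fin k → ℕ} {f : Fin k → A K n} {j : Fin k}
    {u : Fin n →₀ ℕ} (hu : coeff u (f j) ≠ 0) : wdeg ω u + ε j ≤ maxWt ω ε f :=
  (Finset.le_sup (f := fun u => wdeg ω u + ε j) (mem_support_iff.2 hu)).trans
    (Finset.le_sup (f := fun j => (f j).support.sup fun u => wdeg ω u + ε j) (Finset.mem_univ j))

theorem maxWt_le {ω : Fin n → ℕ} {ε : Fin k → ℕ} {f : Fin k → A K n} {w : ℕ}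
    (h : WLt ω ε (w + 1) f) : maxWt ω ε f ≤ w :=
  Finset.sup_le fun j _ => Finset.sup_le fun u hu =>
    Nat.le_of_lt_succ (h j u (mem_support_iff.1 hu))

theorem inMod_eq (ω : Fin n → ℕ) (ε : Fin k → ℕ) : inMod ω ε M = ini ω ε M := by
  classical
  refine le_antisymm (Submodule.span_le.2 ?_) (Submodule.span_le.2 ?_)
  · rintro _ ⟨f, hf, -, rfl⟩
    rw [inForm_eq]
    exact cmp_mem_ini hf fun j u hu => Nat.lt_succ_of_le (le_maxWt hu)
  · rintro _ ⟨w, f, hf, hw, rfl⟩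
    by_cases h0 : cmp ω ε w f = 0
    · rw [h0]
      exact zero_mem _
    · have : ∃ j u, coeff u (cmp ω ε w f j) ≠ 0 := by
        by_contra! hc
        exact h0 (vec_ext hc)
      obtain ⟨j, u, hu⟩ := this
      rw [coeff_cut] at hu
      have hw' : maxWt ω ε f = w := by
        have h1 := maxWt_le hw
        have h2 : wdeg ω u + ε j ≤ maxWt ω ε f := le_maxWt (by grind)
        grind
      refine Submodule.subset_span ⟨f, hf, ?_, ?_⟩
      · rintro rfl
        simp at h0
      · rw [inForm_eq, hw']

theorem inMod_zero : inMod 0 0 M = M := by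
  have h (f : Fin k → A K n) : cmp 0 0 0 f = f := by
    refine vec_ext fun j u => ?_
    rw [coeff_cut]
    simp [wdeg]
  rw [inMod_eq]
  refine le_antisymm (Submodule.span_le.2 ?_) fun f hf => ?_
  · rintro _ ⟨w, f, hf, -, rfl⟩
    rcases w with _ | w
    · rwa [h]
    · have h0 : cmp 0 0 (w + 1) f = 0 := by
        refine vec_ext fun j u => ?_
        rw [coeff_cut]
        simp [wdeg]
      rw [h0]
      exact zero_mem _
  · rw [← h f]
    exact cmp_mem_ini hf fun j u _ => by simp [wdeg]

end Dictionary

section Resolutions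

variable {K : Type*} [Field K] {n k : ℕ} {d : Fin k → ℕ} {M : Submodule (A K n) (Fin k → A K n)}

theorem GFRes.gm_aug (R : GFRes d M) : GM 1 (R.sh 0) d R.aug :=
  gm_of_single fun l => isHomog_iff.1 (R.aug_hom l)

theorem GFRes.gm_diff (R : GFRes d M) (i : ℕ) : GM 1 (R.sh (i + 1)) (R.sh i) (R.diff i) :=
  gm_of_single fun l => isHomog_iff.1 (R.diff_hom i l)

theorem GFRes.Minimal.range {R : GFRes d M} (hR : R.Minimal) (i : ℕ) :
    MMin (LinearMap.range (R.diff i)) := by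
  rintro _ ⟨x, rfl⟩
  exact hR i x

theorem GFRes.Minimal.ker_aug {R : GFRes d M} (hR : R.Minimal) : MMin (LinearMap.ker R.aug) :=
  R.ex0 ▸ hR.range 0

theorem GFRes.Minimal.ker_diff {R : GFRes d M} (hR : R.Minimal) (i : ℕ) :
    MMin (LinearMap.ker (R.diff i)) := R.exs i ▸ hR.range (i + 1)

theorem GFRes.reg_range {R : GFRes d M} {r : ℕ} (h : ∀ i l, R.sh i l ≤ i + r) (t i : ℕ) :
    Reg t (R.sh i) (LinearMap.range (R.diff i)) (i + 1 + r) := by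
  induction t generalizing i with
  | zero => trivial
  | succ t ih =>
    refine ⟨_, inferInstance, _, R.diff i, R.gm_diff i, h (i + 1), rfl, ?_⟩
    rw [← R.exs i]
    exact (ih (i + 1)).mono (by omega)

theorem RegLE.reg {r : ℕ} (h : RegLE d M r) (t : ℕ) : Reg t d M r := by
  obtain ⟨R, -, hR⟩ := h
  rcases t with _ | t
  · trivial
  refine ⟨_, inferInstance, _, R.aug, R.gm_aug, fun l => by simpa using hR 0 l, R.aug_range, ?_⟩
  rw [← R.ex0]
  exact (GFRes.reg_range hR t 0).mono (by omega)

theorem GFRes.Minimal.sh_le {R : GFRes d M} (hR : R.Minimal) {r : ℕ} (h : ∀ t, Reg t d M r)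
    (i : ℕ) (l : Fin (R.rk i)) : R.sh i l ≤ i + r := by
  suffices H : ∀ i, (∀ l, R.sh i l ≤ i + r) ∧
      ∀ t, Reg t (R.sh i) (LinearMap.range (R.diff i)) (i + r + 1) from (H i).1 l
  intro i
  induction i with
  | zero =>
    have h1 := fun t => (h (t + 1)).of_minimal R.gm_aug R.aug_range hR.ker_aug
    rw [R.ex0, Nat.zero_add]
    exact ⟨(h1 0).1, fun t => (h1 t).2⟩
  | succ i ih =>
    have h1 := fun t => (ih.2 (t + 1)).of_minimal (R.gm_diff i) rfl (hR.ker_diff i)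
    rw [R.exs, show i + 1 + r = i + r + 1 by omega]
    exact ⟨(h1 0).1, fun t => (h1 t).2⟩

theorem GFRes.Minimal.cl_diff {R : GFRes d M} (hR : R.Minimal) {i j : ℕ} (hij : i ≤ j)
    (h : CL (R.sh i) (LinearMap.range (R.diff i))) :
    CL (R.sh j) (LinearMap.range (R.diff j)) := by
  induction j, hij using Nat.le_induction with
  | base => exact h
  | succ j _ ih =>
    rw [R.exs]
    exact ih.ker (R.gm_diff j) rfl (hR.ker_diff j)

theorem GFRes.Minimal.cl_diff_of_cl {R : GFRes d M} (hR : R.Minimal) (h : CL d M) (j : ℕ) :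
    CL (R.sh j) (LinearMap.range (R.diff j)) := by
  refine hR.cl_diff (Nat.zero_le j) ?_
  rw [R.ex0]
  exact h.ker R.gm_aug R.aug_range hR.ker_aug

/-- Level `i` of the minimal resolution `R` is a graded direct summand of level `i` of `G`,
compatibly with the images of the differentials. -/
theorem GFRes.Minimal.exists_retract {R : GFRes d M} (hR : R.Minimal) (G : GFRes d M) (i : ℕ) :
    ∃ (α : (Fin (R.rk i) → A K n) →ₗ[A K n] (Fin (G.rk i) → A K n))
      (β : (Fin (G.rk i) → A K n) →ₗ[A K n] (Fin (R.rk i) → A K n)),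
      GM 1 (R.sh i) (G.sh i) α ∧ GM 1 (G.sh i) (R.sh i) β ∧
      (∀ x ∈ LinearMap.range (R.diff i), α x ∈ LinearMap.range (G.diff i)) ∧
      (∀ x ∈ LinearMap.range (G.diff i), β x ∈ LinearMap.range (R.diff i)) ∧
      ∀ x, β (α x) = x := by
  induction i with
  | zero =>
    have hr : LinearMap.range G.aug = LinearMap.range R.aug := G.aug_range.trans R.aug_range.symm
    obtain ⟨α, β, hα, hβ, hα1, hβ1, hβα⟩ := exists_retract_lift G.gm_aug R.gm_aug gm_id gm_id
      (fun x => hr ▸ ⟨x, rfl⟩) (fun x => hr ▸ ⟨x, rfl⟩) (fun x => rfl) hR.ker_aug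
    refine ⟨α, β, hα, hβ, fun x hx => ?_, fun x hx => ?_, hβα⟩
    · rw [R.ex0] at hx
      rw [G.ex0, LinearMap.mem_ker, hα1, LinearMap.mem_ker.1 hx, map_zero]
    · rw [G.ex0] at hx
      rw [R.ex0, LinearMap.mem_ker, hβ1, LinearMap.mem_ker.1 hx, map_zero]
  | succ i ih =>
    obtain ⟨a, p, ha, hp, har, hpr, hpa⟩ := ih
    obtain ⟨α, β, hα, hβ, hα1, hβ1, hβα⟩ := exists_retract_lift (G.gm_diff i) (R.gm_diff i) ha hp
      (fun x => har _ ⟨x, rfl⟩) (fun x => hpr _ ⟨x, rfl⟩) (fun x => hpa _) (hR.ker_diff i)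
    refine ⟨α, β, hα, hβ, fun x hx => ?_, fun x hx => ?_, hβα⟩
    · rw [R.exs] at hx
      rw [G.exs, LinearMap.mem_ker, hα1, LinearMap.mem_ker.1 hx, map_zero]
    · rw [G.exs] at hx
      rw [R.exs, LinearMap.mem_ker, hβ1, LinearMap.mem_ker.1 hx, map_zero]

theorem rightInverse_of_leftInverse {a b : ℕ} (hab : a = b)
    {α : (Fin a → A K n) →ₗ[A K n] (Fin b → A K n)}
    {β : (Fin b → A K n) →ₗ[A K n] (Fin a → A K n)} (h : ∀ x, β (α x) = x) (y : Fin b → A K n) :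
    α (β y) = y := by
  subst hab
  have hβ : Function.Injective β :=
    OrzechProperty.injective_of_surjective_endomorphism β fun x => ⟨_, h x⟩
  exact hβ (h _)

theorem map_mem_mIdeal {a b : ℕ} (α : (Fin a → A K n) →ₗ[A K n] (Fin b → A K n))
    {x : Fin a → A K n} (hx : ∀ l, x l ∈ mIdeal K n) (l : Fin b) : α x l ∈ mIdeal K n := by
  rw [pi_eq_sum_univ' x, map_sum, Finset.sum_apply]
  refine Ideal.sum_mem _ fun j _ => ?_
  rw [map_smul]
  exact Ideal.mul_mem_right _ _ (hx j)

theorem GFRes.Minimal.ker_aug_of_rk_eq {R : GFRes d M} (hR : R.Minimal) (G : GFRes d M)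
    (h : R.rk 0 = G.rk 0) : MMin (LinearMap.ker G.aug) := by
  obtain ⟨α, β, -, -, -, hβ, hβα⟩ := hR.exists_retract G 0
  intro x hx
  rw [← G.ex0] at hx
  rw [← rightInverse_of_leftInverse h hβα x]
  exact map_mem_mIdeal α (hR.range 0 _ (hβ x hx))

theorem GFRes.Minimal.range_of_rk_eq {R : GFRes d M} (hR : R.Minimal) (G : GFRes d M) {i : ℕ}
    (h : R.rk (i + 1) = G.rk (i + 1)) : MMin (LinearMap.range (G.diff i)) := by
  obtain ⟨a, p, ha, hp, har, hpr, hpa⟩ := hR.exists_retract G i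
  obtain ⟨α, β, -, -, hα1, hβ1, hβα⟩ := exists_retract_lift (G.gm_diff i) (R.gm_diff i) ha hp
    (fun x => har _ ⟨x, rfl⟩) (fun x => hpr _ ⟨x, rfl⟩) (fun x => hpa _) (hR.ker_diff i)
  rintro _ ⟨x, rfl⟩
  rw [← rightInverse_of_leftInverse h hβα x, hα1]
  exact map_mem_mIdeal a (hR i _)

end Resolutions

section DegenerateResolutions

variable {K : Type*} [Field K] {n : ℕ}

/-- A graded submodule of a graded free module carrying additional weights. -/
structure WeightedSub (K : Type*) [Field K] (n : ℕ) where
  rk : ℕ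
  sh : Fin rk → ℕ
  wt : Fin rk → ℕ
  sub : Submodule (A K n) (Fin rk → A K n)
  gr : Gr 1 sh sub

namespace WeightedSub

variable (ω : Fin n → ℕ) (S : WeightedSub K n)

/-- The module of relations in the presentation of `exists_degenPres`. -/
noncomputable def next : WeightedSub K n :=
  have h := exists_degenPres ω S.wt S.gr
  ⟨h.choose, h.choose_spec.choose_spec.choose, h.choose_spec.choose,
    LinearMap.ker h.choose_spec.choose_spec.choose_spec.choose,
    h.choose_spec.choose_spec.choose_spec.choose_spec.choose_spec.gm.gr_ker⟩

/-- The presentation of `exists_degenPres`. -/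
noncomputable def pres : (Fin (S.next ω).rk → A K n) →ₗ[A K n] (Fin S.rk → A K n) :=
  (exists_degenPres ω S.wt S.gr).choose_spec.choose_spec.choose_spec.choose

/-- The leading part of the presentation of `exists_degenPres`. -/
noncomputable def lead : (Fin (S.next ω).rk → A K n) →ₗ[A K n] (Fin S.rk → A K n) :=
  (exists_degenPres ω S.wt S.gr).choose_spec.choose_spec.choose_spec.choose_spec.choose

theorem degenPres : DegenPres ω S.wt S.sh S.sub (S.next ω).wt (S.next ω).sh (S.pres ω)
    (S.lead ω) :=
  (exists_degenPres ω S.wt S.gr).choose_spec.choose_spec.choose_spec.choose_spec.choose_spec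

theorem ker_lead : LinearMap.ker (S.lead ω) = ini ω (S.next ω).wt (S.next ω).sub :=
  (S.degenPres ω).ker₀

/-- Iterated modules of relations. -/
noncomputable def syz : ℕ → WeightedSub K n
  | 0 => S
  | i + 1 => (syz i).next ω

/-- A resolution degenerating to a minimal resolution of the initial module. -/
noncomputable def res : GFRes S.sh S.sub where
  rk i := (S.syz ω (i + 1)).rk
  sh i := (S.syz ω (i + 1)).sh
  aug := S.pres ω
  diff i := (S.syz ω (i + 1)).pres ω
  aug_range := (S.degenPres ω).range
  aug_hom l := isHomog_iff.2 ((S.degenPres ω).gm _ _ (hg_single l))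
  diff_hom i l := isHomog_iff.2 (((S.syz ω (i + 1)).degenPres ω).gm _ _ (hg_single l))
  ex0 := ((S.syz ω 1).degenPres ω).range
  exs i := ((S.syz ω (i + 2)).degenPres ω).range

/-- The minimal resolution of the initial module. -/
noncomputable def leadRes : GFRes S.sh (inMod ω S.wt S.sub) where
  rk i := (S.syz ω (i + 1)).rk
  sh i := (S.syz ω (i + 1)).sh
  aug := S.lead ω
  diff i := (S.syz ω (i + 1)).lead ω
  aug_range := (S.degenPres ω).range₀.trans (inMod_eq _ _).symm
  aug_hom l := isHomog_iff.2 ((S.degenPres ω).gm₀ _ _ (hg_single l))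
  diff_hom i l := isHomog_iff.2 (((S.syz ω (i + 1)).degenPres ω).gm₀ _ _ (hg_single l))
  ex0 := ((S.syz ω 1).degenPres ω).range₀.trans (S.ker_lead ω).symm
  exs i := ((S.syz ω (i + 2)).degenPres ω).range₀.trans ((S.syz ω (i + 1)).ker_lead ω).symm

theorem minimal_leadRes : (S.leadRes ω).Minimal := by
  intro i x
  have h : LinearMap.range ((S.leadRes ω).diff i) = LinearMap.ker ((S.syz ω i).lead ω) :=
    ((S.syz ω (i + 1)).degenPres ω).range₀.trans ((S.syz ω i).ker_lead ω).symm
  exact ((S.syz ω i).degenPres ω).min₀ _ (h ▸ ⟨x, rfl⟩)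

variable {ω S}

theorem cl_ini_syz (h : CL S.sh (ini ω S.wt S.sub)) (i : ℕ) :
    CL (S.syz ω i).sh (ini ω (S.syz ω i).wt (S.syz ω i).sub) := by
  induction i with
  | zero => exact h
  | succ i ih =>
    have hi := (S.syz ω i).degenPres ω
    exact (S.syz ω i).ker_lead ω ▸ ih.ker hi.gm₀ hi.range₀ hi.min₀

theorem cl_syz (h : CL S.sh (ini ω S.wt S.sub)) {i : ℕ} (hm : MMin (S.syz ω (i + 1)).sub) :
    CL (S.syz ω i).sh (S.syz ω i).sub :=
  ((S.syz ω i).degenPres ω).cl hm (cl_ini_syz h i)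

end WeightedSub

end DegenerateResolutions

section ComponentwiseLinear

variable {K : Type*} [Field K] {n k : ℕ} {d : Fin k → ℕ} {M : Submodule (A K n) (Fin k → A K n)}

theorem exists_minimal_gfRes (hM : Gr 1 d M) : ∃ R : GFRes d M, R.Minimal := by
  have h := (WeightedSub.mk k d 0 M hM).minimal_leadRes 0
  have h' : ∃ R : GFRes d (inMod 0 0 M), R.Minimal := ⟨_, h⟩
  rwa [inMod_zero] at h'

theorem CompLinear.cl (h : CompLinear d M) : CL d M := by
  refine cl_of_reg_eqSub fun a t => ?_
  rw [← compSub_eq]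
  rcases h a with h | h
  · exact h ▸ reg_bot
  · exact h.reg t

theorem CL.compLinear (h : CL d M) : CompLinear d M := by
  intro a
  obtain ⟨R, hR⟩ := exists_minimal_gfRes (gr_eqSub (d := d) (M := M) (a := a))
  rw [compSub_eq]
  exact Or.inr ⟨R, hR, hR.sh_le (h.reg_eqSub a)⟩

end ComponentwiseLinear

end CregPaper

namespace CregPaper

/-- **Theorem 5.7.** Let `M ⊆ F` be graded with `in_{(ω,ε)}(M)`
componentwise linear. If `β_i(M) = β_i(in_{(ω,ε)}(M))` for some `i ≥ 0`, then
the syzygy module `Ω_j^A(M)` is componentwise linear for all `j ≥ i − 2`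
(where `Ω_j = M` for `j < 0`, and `Ω_j = range(∂ in homological degree j)`
in a minimal graded free resolution of `M` for `j ≥ 0`). -/
theorem syzygies_componentwise_linear
    {K : Type*} [Field K] {n k : ℕ} (ω : Fin n → ℕ) (d ε : Fin k → ℕ)
    (M : Submodule (A K n) (Fin k → A K n)) (hM : IsGradedSub d M)
    (hin : CompLinear d (inMod ω ε M)) (i : ℕ)
    (hbeta : ∀ (res1 : GFRes d M) (res2 : GFRes d (inMod ω ε M)),
      res1.Minimal → res2.Minimal → res1.rk i = res2.rk i)
    (res : GFRes d M) (hres : res.Minimal) :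
    ((i : ℤ) - 2 ≤ -1 → CompLinear d M) ∧
    ∀ j : ℕ, (i : ℤ) - 2 ≤ (j : ℤ) →
      CompLinear (res.sh j) (LinearMap.range (res.diff j)) := by
  let S : WeightedSub K n := ⟨k, d, ε, M, isGradedSub_iff.1 hM⟩
  have hrk : res.rk i = (S.res ω).rk i := hbeta res (S.leadRes ω) hres (S.minimal_leadRes ω)
  have hcl : CL S.sh (ini ω S.wt S.sub) := inMod_eq (M := M) ω ε ▸ hin.cl
  have of_cl (h : CL d M) : ((i : ℤ) - 2 ≤ -1 → CompLinear d M) ∧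
      ∀ j : ℕ, (i : ℤ) - 2 ≤ (j : ℤ) →
        CompLinear (res.sh j) (LinearMap.range (res.diff j)) :=
    ⟨fun _ => h.compLinear, fun j _ => (hres.cl_diff_of_cl h j).compLinear⟩
  have hrange (i : ℕ) : LinearMap.range ((S.res ω).diff i) = (S.syz ω (i + 1)).sub :=
    ((S.syz ω (i + 1)).degenPres ω).range
  rcases i with _ | _ | i
  · exact of_cl (WeightedSub.cl_syz (i := 0) hcl (hres.ker_aug_of_rk_eq (S.res ω) hrk))
  · exact of_cl (WeightedSub.cl_syz (i := 0) hcl (hrange 0 ▸ hres.range_of_rk_eq (S.res ω) hrk))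
  · refine ⟨fun h => absurd h (by push_cast; omega), fun j hj => ?_⟩
    have h1 : CL (S.syz ω (i + 1)).sh (S.syz ω (i + 1)).sub :=
      WeightedSub.cl_syz hcl (hrange (i + 1) ▸ hres.range_of_rk_eq (S.res ω) hrk)
    rw [← hrange] at h1
    obtain ⟨α, β, hα, hβ, hα1, hβ1, hβα⟩ := hres.exists_retract (S.res ω) i
    exact (hres.cl_diff (i := i) (by push_cast at hj; omega)
      (CL.retract hα hβ hα1 hβ1 (fun x _ => hβα x) h1)).compLinear

end CregPaper
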